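/- arXiv:2105.04204 — 4 statements merged into one kernel-verified Lean document; each statement's English description precedes it below -/
import Mathlib

section
/- For every natural number n there exist a totally real cubic field K, an algebraic unit ρ of degree 3 generating K, and an element α of the order ℤ[ρ] that is indecomposable in ℤ[ρ], such that Tr_{K/ℚ}(αδ) > n for every δ ∈ ℤ[ρ]^{∨,+}. -/
open IntermediateField

noncomputable section

/-- An element of a field `K` is totally positive if its image under every
real embedding of `K` is positive. -/
def TotallyPositive {K : Type*} [Field K] (x : K) : Prop :=
  ∀ φ : K →+* ℝ, 0 < φ x

/-- A totally positive element `α` of an order `O` is (additively) indecomposable in `O`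
if it cannot be written as a sum of two totally positive elements of `O`. -/
def IsIndecomposableIn {K : Type*} [Field K] (O : Subalgebra ℤ K) (α : K) : Prop :=
  α ∈ O ∧ TotallyPositive α ∧
    ¬ ∃ β γ : K, β ∈ O ∧ γ ∈ O ∧ TotallyPositive β ∧ TotallyPositive γ ∧ α = β + γ

/-- The set of totally positive elements of the codifferent of an order `O`:
`O^{∨,+} = {δ ∈ K totally positive : Tr_{K/ℚ}(αδ) ∈ ℤ for all α ∈ O}`. -/
def CodifferentPlus {K : Type*} [Field K] [Algebra ℚ K] (O : Subalgebra ℤ K) : Set K :=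
  {δ : K | TotallyPositive δ ∧ ∀ α ∈ O, ∃ n : ℤ, Algebra.trace ℚ K (α * δ) = (n : ℚ)}

open Polynomial

/-- Existence of three real roots of `x (x - a) (x - 2a) - 1`, with localisation. -/
lemma aux_roots (a : ℝ) (ha : 3 ≤ a) : ∃ r₁ r₂ r₃ : ℝ,
    (0 < r₁ ∧ r₁ < 1 ∧ r₁ * (r₁ - a) * (r₁ - 2 * a) = 1) ∧
    (a - 1 < r₂ ∧ r₂ < a ∧ r₂ * (r₂ - a) * (r₂ - 2 * a) = 1) ∧
    (2 * a < r₃ ∧ r₃ < 2 * a + 1 ∧ r₃ * (r₃ - a) * (r₃ - 2 * a) = 1) := by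
  have hc : Continuous (fun x : ℝ => x * (x - a) * (x - 2 * a)) := by fun_prop
  obtain ⟨r₁, h₁, e₁⟩ := intermediate_value_Ioo (by norm_num : (0 : ℝ) ≤ 1) hc.continuousOn
    (show (1 : ℝ) ∈ _ by constructor <;> nlinarith)
  obtain ⟨r₂, h₂, e₂⟩ := intermediate_value_Ioo' (by linarith : a - 1 ≤ a) hc.continuousOn
    (show (1 : ℝ) ∈ _ by constructor <;> nlinarith)
  obtain ⟨r₃, h₃, e₃⟩ := intermediate_value_Ioo (by linarith : 2 * a ≤ 2 * a + 1) hc.continuousOn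
    (show (1 : ℝ) ∈ _ by constructor <;> nlinarith)
  exact ⟨r₁, r₂, r₃, ⟨h₁.1, h₁.2, e₁⟩, ⟨h₂.1, h₂.2, e₂⟩, ⟨h₃.1, h₃.2, e₃⟩⟩

/-- The minimal polynomial, over `ℤ`. -/
def auxPoly (a : ℤ) : ℤ[X] := X ^ 3 - C (3 * a) * X ^ 2 + C (2 * a ^ 2) * X - 1

lemma auxPoly_natDegree (a : ℤ) : (auxPoly a).natDegree = 3 := by
  unfold auxPoly; compute_degree!

lemma auxPoly_monic (a : ℤ) : (auxPoly a).Monic := by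
  unfold auxPoly; monicity!

lemma auxPoly_aeval {R : Type*} [CommRing R] (a : ℤ) (x : R) :
    aeval x (auxPoly a) = x * (x - a) * (x - 2 * a) - 1 := by
  have h3 : aeval x (3 : ℤ[X]) = 3 := map_ofNat _ 3
  have h2 : aeval x (2 : ℤ[X]) = 2 := map_ofNat _ 2
  simp [auxPoly, h2, h3]
  ring

lemma auxPoly_irreducible (a : ℤ) (ha : 3 ≤ a) : Irreducible (auxPoly a) := by
  rw [(auxPoly_monic a).irreducible_iff_roots_eq_zero_of_degree_le_three
    (by rw [auxPoly_natDegree]; norm_num) (by rw [auxPoly_natDegree])]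
  rw [Multiset.eq_zero_iff_forall_notMem]
  intro x hx
  have h := (mem_roots'.1 hx).2
  rw [IsRoot.def, ← coe_aeval_eq_eval, auxPoly_aeval] at h
  have h1 : x * ((x - a) * (x - 2 * a)) = 1 := by simp at h; linarith
  rcases Int.eq_one_or_neg_one_of_mul_eq_one h1 with rfl | rfl <;> nlinarith

lemma auxPoly_minpoly (a : ℤ) (ha : 3 ≤ a) {K : Type*} [Field K] [Algebra ℚ K] (r : K)
    (hr : r * (r - a) * (r - 2 * a) = 1) :
    minpoly ℚ r = (auxPoly a).map (algebraMap ℤ ℚ) := by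
  symm
  apply minpoly.eq_of_irreducible_of_monic
  · exact ((auxPoly_monic a).irreducible_iff_irreducible_map_fraction_map (K := ℚ)).1
      (auxPoly_irreducible a ha)
  · rw [aeval_map_algebraMap, auxPoly_aeval, hr, sub_self]
  · exact (auxPoly_monic a).map _

/-- Each element of the order is an integral quadratic polynomial in `b - ρ`. -/
lemma aux_mem {K : Type*} [Field K] (a b : ℤ) (r : K)
    (hr : r * (r - a) * (r - 2 * a) = 1) (β : K) (hβ : β ∈ Algebra.adjoin ℤ {r}) :
    ∃ x y z : ℤ, β = x + y * (b - r) + z * (b - r) ^ 2 := by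
  rw [Algebra.adjoin_singleton_eq_range_aeval] at hβ
  obtain ⟨p, rfl⟩ := hβ
  have h0 : aeval r (auxPoly a) = 0 := by rw [auxPoly_aeval, hr, sub_self]
  have hp : aeval r p = aeval r (p %ₘ auxPoly a) := by
    conv_lhs => rw [← modByMonic_add_div p (auxPoly a)]
    simp [h0]
  have hd : (p %ₘ auxPoly a).natDegree < 3 := by
    rw [← auxPoly_natDegree a]
    refine natDegree_modByMonic_lt _ (auxPoly_monic a) ?_
    intro h
    have := auxPoly_natDegree a
    rw [h] at this
    simp at this
  set q := p %ₘ auxPoly a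
  refine ⟨q.coeff 0 + b * q.coeff 1 + b ^ 2 * q.coeff 2, -q.coeff 1 - 2 * b * q.coeff 2,
    q.coeff 2, ?_⟩
  change aeval r p = _
  rw [hp, aeval_eq_sum_range' hd]
  simp [Finset.sum_range_succ]
  ring

/-- The real inequality behind indecomposability. -/
lemma aux_indec (m : ℝ) (hm : 0 ≤ m) (t₁ t₂ e : ℝ) (x y z : ℤ) (he : 0 < e) (h2 : 0 < t₂)
    (h1 : 1 ≤ t₁) (h12 : m + 1 ≤ t₁ - t₂) (hx : x ≤ 0)
    (p3 : 0 < (x : ℝ) + y * (-e) + z * (-e) ^ 2)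
    (p2 : 0 < (x : ℝ) + y * t₂ + z * t₂ ^ 2)
    (p1 : (x : ℝ) + y * t₁ + z * t₁ ^ 2 < 1 + m * t₁) : False := by
  have hx' : (x : ℝ) ≤ 0 := by exact_mod_cast hx
  have a3 : (y : ℝ) < z * e := by
    by_contra! h
    nlinarith [mul_le_mul_of_nonneg_left h he.le]
  have a2 : 0 < (y : ℝ) + z * t₂ := by
    by_contra! h
    nlinarith [mul_le_mul_of_nonneg_left h h2.le]
  have hz : 0 < (z : ℝ) := by
    by_contra! h
    nlinarith [mul_nonneg (neg_nonneg.2 h) (add_pos he h2).le]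
  have hz1 : (1 : ℝ) ≤ z := by
    have : 0 < z := by exact_mod_cast hz
    exact_mod_cast this
  have k1 : (m + 1) * t₁ ≤ (t₁ - t₂) * t₁ := by nlinarith
  have k2 : (t₁ - t₂) * t₁ ≤ (t₁ - t₂) * (y + z * (t₁ + t₂)) := by
    apply mul_le_mul_of_nonneg_left _ (by linarith)
    nlinarith
  nlinarith

/-- The real inequality behind the lower bound of traces. -/
lemma aux_trace (n a : ℝ) (hn : 0 ≤ n) (ha : a = n + 3) (r₁ r₂ r₃ d₁ d₂ d₃ : ℝ)
    (h₁ : 0 < r₁) (h₁' : r₁ < 1) (h₂ : a - 1 < r₂) (h₂' : r₂ < a) (h₃ : 2 * a < r₃)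
    (h₃' : r₃ < 2 * a + 1)
    (e₃ : r₃ * (r₃ - a) * (r₃ - 2 * a) = 1) (p₁ : 0 < d₁) (p₂ : 0 < d₂) (p₃ : 0 < d₃)
    (u v w : ℤ) (hu : (u : ℝ) = d₁ + d₂ + d₃)
    (hv : (v : ℝ) = (2 * a - r₁) * d₁ + (2 * a - r₂) * d₂ + (2 * a - r₃) * d₃)
    (hw : (w : ℝ) = (2 * a - r₁) ^ 2 * d₁ + (2 * a - r₂) ^ 2 * d₂ + (2 * a - r₃) ^ 2 * d₃) :
    n < u + n * v := by
  have hu1 : (1 : ℝ) ≤ u := by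
    have : (0 : ℝ) < u := by rw [hu]; positivity
    have : 0 < u := by exact_mod_cast this
    exact_mod_cast this
  obtain ⟨e, he⟩ : ∃ e, e = r₃ - 2 * a := ⟨_, rfl⟩
  have he0 : 0 < e := by linarith
  have hea : e * (r₃ * a) < 1 := by
    rw [← e₃, he]
    have : 0 < r₃ * (r₃ - 2 * a) := mul_pos (by linarith) (by linarith)
    nlinarith
  rcases lt_trichotomy v 0 with h | h | h
  · have hv1 : (v : ℝ) ≤ -1 := by
      have : v ≤ -1 := by omega
      exact_mod_cast this
    have k1 : -(v : ℝ) ≤ e * u := by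
      rw [hv, hu, he]
      nlinarith [mul_pos (show 0 < r₃ - r₁ by linarith) p₁,
        mul_pos (show 0 < r₃ - r₂ by linarith) p₂]
    have k2 : -(v : ℝ) * (r₃ * a) < u := by
      have : 0 < r₃ * a := mul_pos (by linarith) (by linarith)
      nlinarith
    have k3 : 2 * n ≤ r₃ * a := by nlinarith
    nlinarith
  · have hv0 : (v : ℝ) = 0 := by exact_mod_cast h
    have hw1 : (1 : ℝ) ≤ w := by
      have : (0 : ℝ) < w := by
        rw [hw]
        have : 0 < 2 * a - r₁ := by linarith
        positivity
      have : 0 < w := by exact_mod_cast this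
      exact_mod_cast this
    have k1 : (w : ℝ) ≤ e * r₃ * u := by
      -- `w - (2a - r₁) v ≤ e (r₃ - r₁) d₃`
      have k : (w : ℝ) ≤ e * (r₃ - r₁) * d₃ := by
        have : (w : ℝ) - (2 * a - r₁) * v
            = e * (r₃ - r₁) * d₃ - (2 * a - r₂) * (r₂ - r₁) * d₂ := by
          rw [hw, hv, he]; ring
        have h5 : 0 < (2 * a - r₂) * (r₂ - r₁) * d₂ :=
          mul_pos (mul_pos (by linarith) (by linarith)) p₂
        rw [hv0] at this
        linarith
      refine k.trans ?_
      have : d₃ ≤ u := by linarith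
      exact mul_le_mul (mul_le_mul_of_nonneg_left (by linarith) he0.le) this p₃.le
        (mul_nonneg he0.le (by linarith))
    have k2 : a ≤ u := by
      have : a * 1 ≤ a * (e * r₃ * u) :=
        mul_le_mul_of_nonneg_left (hw1.trans k1) (by linarith)
      nlinarith
    rw [hv0]; linarith
  · have hv1 : (1 : ℝ) ≤ v := by exact_mod_cast h
    nlinarith

lemma aux_lift {F E : Type*} [Field F] [Field E] [Algebra F E] (ρ : E) (h : IsIntegral F ρ)
    (r : E) (hr : aeval r (minpoly F ρ) = 0) :
    ∃ ψ : F⟮ρ⟯ →+* E, ψ (AdjoinSimple.gen F ρ) = r := by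
  have hz : aeval r (minpoly F (IntermediateField.adjoin.powerBasis h).gen) = 0 := by
    rw [IntermediateField.adjoin.powerBasis_gen, IntermediateField.minpoly_gen, hr]
  have hl := (IntermediateField.adjoin.powerBasis h).lift_gen r hz
  refine ⟨((IntermediateField.adjoin.powerBasis h).lift r hz).toRingHom, ?_⟩
  have hg' := IntermediateField.adjoin.powerBasis_gen h
  rw [← hg']
  exact hl

theorem stmt_0 (n : ℕ) :
    ∃ ρ : ℝ, IsIntegral ℤ ρ ∧ IsIntegral ℤ ρ⁻¹ ∧
      Module.finrank ℚ ℚ⟮ρ⟯ = 3 ∧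
      (∀ (φ : ℚ⟮ρ⟯ →+* ℂ) (x : ℚ⟮ρ⟯), (φ x).im = 0) ∧
      ∃ α : ℚ⟮ρ⟯,
        IsIndecomposableIn (Algebra.adjoin ℤ {AdjoinSimple.gen ℚ ρ}) α ∧
        ∀ δ ∈ CodifferentPlus (Algebra.adjoin ℤ {AdjoinSimple.gen ℚ ρ}),
          (n : ℚ) < Algebra.trace ℚ ℚ⟮ρ⟯ (α * δ) := by
  classical
  obtain ⟨a, ha⟩ : ∃ a : ℤ, a = n + 3 := ⟨_, rfl⟩
  have ha3 : 3 ≤ a := by omega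
  have haR : (a : ℝ) = n + 3 := by rw [ha]; push_cast; ring
  obtain ⟨r₁, r₂, ρ, ⟨h₁, h₁', e₁⟩, ⟨h₂, h₂', e₂⟩, ⟨h₃, h₃', e₃⟩⟩ :=
    aux_roots a (by exact_mod_cast ha3)
  have hn0 : (0 : ℝ) ≤ n := Nat.cast_nonneg n
  have hint : IsIntegral ℤ ρ :=
    ⟨auxPoly a, auxPoly_monic a, by
      have := auxPoly_aeval a ρ
      rw [e₃, sub_self] at this
      exact this⟩
  have hintQ : IsIntegral ℚ ρ := hint.tower_top
  have hρ0 : ρ ≠ 0 := by rintro rfl; simp at e₃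
  have hinv : ρ⁻¹ = (ρ - (a : ℤ)) * (ρ - (2 * a : ℤ)) := by
    push_cast
    field_simp
    linarith
  have hfin : Module.finrank ℚ ℚ⟮ρ⟯ = 3 := by
    rw [IntermediateField.adjoin.finrank hintQ, auxPoly_minpoly a ha3 ρ e₃,
      (auxPoly_monic a).natDegree_map, auxPoly_natDegree]
  have hfd : FiniteDimensional ℚ ℚ⟮ρ⟯ := IntermediateField.adjoin.finiteDimensional hintQ
  -- the generator
  obtain ⟨g, hg⟩ : ∃ g, g = AdjoinSimple.gen ℚ ρ := ⟨_, rfl⟩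
  have hgρ : (g : ℝ) = ρ := by rw [hg]; simp
  have hgeq : g * (g - a) * (g - 2 * a) = 1 := by
    apply Subtype.ext
    push_cast
    rw [hgρ]; exact e₃
  -- embeddings determined by roots
  have hemb : ∀ r : ℝ, r * (r - a) * (r - 2 * a) = 1 → ∃ φ : ℚ⟮ρ⟯ →ₐ[ℚ] ℝ, φ g = r := by
    intro r hr
    have hz : aeval r (minpoly ℚ ρ) = 0 := by
      rw [auxPoly_minpoly a ha3 ρ e₃, aeval_map_algebraMap, auxPoly_aeval, hr, sub_self]
    obtain ⟨ψ, hψ⟩ := aux_lift ρ hintQ r hz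
    exact ⟨ψ.toRatAlgHom, by rw [hg]; exact hψ⟩
  obtain ⟨φ₁, hφ₁⟩ := hemb r₁ e₁
  obtain ⟨φ₂, hφ₂⟩ := hemb r₂ e₂
  obtain ⟨φ₃, hφ₃⟩ := hemb ρ e₃
  let ι : ℝ →ₐ[ℚ] ℂ := Complex.ofRealAm.restrictScalars ℚ
  have hι : ∀ x, ι x = (x : ℂ) := fun x => rfl
  have huniv : (Finset.univ : Finset (ℚ⟮ρ⟯ →ₐ[ℚ] ℂ)) = {ι.comp φ₁, ι.comp φ₂, ι.comp φ₃} := by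
    symm
    apply Finset.eq_univ_of_card
    rw [AlgHom.card, hfin]
    have hne : ∀ φ ψ : ℚ⟮ρ⟯ →ₐ[ℚ] ℝ, φ g ≠ ψ g → ι.comp φ ≠ ι.comp ψ := by
      intro φ ψ h h'
      apply h
      have := DFunLike.congr_fun h' g
      simpa [hι] using this
    apply Finset.card_eq_three.2
    refine ⟨_, _, _, hne _ _ ?_, hne _ _ ?_, hne _ _ ?_, rfl⟩ <;>
      simp only [hφ₁, hφ₂, hφ₃] <;> apply ne_of_lt <;> linarith
  have htr : ∀ x : ℚ⟮ρ⟯, ((Algebra.trace ℚ ℚ⟮ρ⟯ x : ℚ) : ℝ) = φ₁ x + φ₂ x + φ₃ x := by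
    intro x
    have := trace_eq_sum_embeddings (K := ℚ) (L := ℚ⟮ρ⟯) ℂ (x := x)
    have hne : ∀ φ ψ : ℚ⟮ρ⟯ →ₐ[ℚ] ℝ, φ g ≠ ψ g → ι.comp φ ≠ ι.comp ψ := by
      intro φ ψ h h'
      apply h
      have := DFunLike.congr_fun h' g
      simpa [hι] using this
    have n12 : ι.comp φ₁ ≠ ι.comp φ₂ := hne _ _ (by rw [hφ₁, hφ₂]; apply ne_of_lt; linarith)
    have n13 : ι.comp φ₁ ≠ ι.comp φ₃ := hne _ _ (by rw [hφ₁, hφ₃]; apply ne_of_lt; linarith)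
    have n23 : ι.comp φ₂ ≠ ι.comp φ₃ := hne _ _ (by rw [hφ₂, hφ₃]; apply ne_of_lt; linarith)
    rw [huniv, Finset.sum_insert (by simp [n12, n13]), Finset.sum_insert (by simp [n23]),
      Finset.sum_singleton] at this
    simp only [AlgHom.comp_apply, hι, eq_ratCast] at this
    have h2 : ((((Algebra.trace ℚ ℚ⟮ρ⟯ x : ℚ) : ℝ)) : ℂ) = ((φ₁ x + φ₂ x + φ₃ x : ℝ) : ℂ) := by
      push_cast
      rw [this]; ring
    exact_mod_cast h2
  have hgmem : g ∈ Algebra.adjoin ℤ {g} := Algebra.self_mem_adjoin_singleton ℤ g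
  have hint' : ∀ k : ℤ, (k : ℚ⟮ρ⟯) ∈ Algebra.adjoin ℤ {g} := fun k => intCast_mem _ k
  have hσ : ((2 * a : ℤ) : ℚ⟮ρ⟯) - g ∈ Algebra.adjoin ℤ {g} := sub_mem (hint' _) hgmem
  -- a real root is one of the three
  have hroot : ∀ r : ℝ, r * (r - a) * (r - 2 * a) = 1 → r < 2 * a + 1 / (n + 1) := by
    intro r hr
    by_contra! h
    have hp : (0 : ℝ) < 1 / (n + 1) := by positivity
    have h5 : (1 : ℝ) / (n + 1) ≤ r - 2 * a := by linarith
    have h6 : (n + 1 : ℝ) ≤ r * (r - a) := by nlinarith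
    have h7 : (1 : ℝ) < r * (r - a) * (1 / (n + 1)) := by
      rw [mul_one_div, one_lt_div (by positivity)]
      nlinarith
    have h8 : r * (r - a) * (1 / (n + 1)) ≤ r * (r - a) * (r - 2 * a) :=
      mul_le_mul_of_nonneg_left h5 (by linarith)
    linarith
  refine ⟨ρ, hint, ?_, hfin, ?_, ?_⟩
  · rw [hinv]
    exact (hint.sub (isIntegral_algebraMap (R := ℤ) (x := a))).mul
      (hint.sub (isIntegral_algebraMap (R := ℤ) (x := 2 * a)))
  · intro φ x
    have hm : φ.toRatAlgHom ∈ (Finset.univ : Finset (ℚ⟮ρ⟯ →ₐ[ℚ] ℂ)) := Finset.mem_univ _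
    rw [huniv] at hm
    have hx : φ x = φ.toRatAlgHom x := rfl
    simp only [Finset.mem_insert, Finset.mem_singleton] at hm
    rw [hx]
    rcases hm with h | h | h <;> rw [h] <;> simp [hι]
  rw [← hg]
  refine ⟨1 + (n : ℤ) * (((2 * a : ℤ) : ℚ⟮ρ⟯) - g), ⟨?_, ?_, ?_⟩, ?_⟩
  · exact add_mem (one_mem _) (mul_mem (hint' _) hσ)
  · intro φ
    have hr : φ g * (φ g - a) * (φ g - 2 * a) = 1 := by
      have := congrArg φ hgeq
      have h2 : φ 2 = 2 := map_ofNat _ 2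
      simpa [h2] using this
    have := hroot _ hr
    simp only [map_add, map_mul, map_sub, map_one, map_intCast]
    push_cast
    have h9 : (n : ℝ) * (φ g - 2 * a) ≤ n * (1 / (n + 1)) :=
      mul_le_mul_of_nonneg_left (by linarith) hn0
    have h10 : (n : ℝ) * (1 / (n + 1)) < 1 := by
      rw [mul_one_div, div_lt_one (by positivity)]; linarith
    linarith
  · rintro ⟨β, γ, hβ, hγ, pβ, pγ, hsum⟩
    have key : ∀ β γ : ℚ⟮ρ⟯, ∀ x y z : ℤ,
        β = x + y * (((2 * a : ℤ) : ℚ⟮ρ⟯) - g) + z * (((2 * a : ℤ) : ℚ⟮ρ⟯) - g) ^ 2 →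
        TotallyPositive β → TotallyPositive γ →
        1 + (n : ℤ) * (((2 * a : ℤ) : ℚ⟮ρ⟯) - g) = β + γ → x ≤ 0 → False := by
      intro β γ x y z hβ pβ pγ hs hx
      have q3 := pβ φ₃.toRingHom
      have q2 := pβ φ₂.toRingHom
      have q1 := pγ φ₁.toRingHom
      have hs1 := congrArg φ₁ hs
      simp only [AlgHom.toRingHom_eq_coe, RingHom.coe_coe] at q1 q2 q3
      rw [hβ] at q2 q3 hs1
      simp only [map_add, map_mul, map_sub, map_one, map_intCast, map_pow, hφ₁, hφ₂, hφ₃]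
        at q1 q2 q3 hs1
      push_cast at q1 q2 q3 hs1
      refine aux_indec n hn0 (2 * a - r₁) (2 * a - r₂) (ρ - 2 * a) x y z (by linarith)
        (by linarith) (by linarith) (by linarith) hx ?_ q2 (by linarith)
      simpa using q3
    obtain ⟨x, y, z, hx⟩ := aux_mem a (2 * a) g hgeq β hβ
    rcases le_or_gt x 0 with h | h
    · exact key β γ x y z hx pβ pγ hsum h
    · refine key γ β (1 - x) (n - y) (-z) ?_ pγ pβ (by rw [hsum, add_comm]) (by omega)
      have : γ = 1 + (n : ℤ) * (((2 * a : ℤ) : ℚ⟮ρ⟯) - g) - β := by rw [hsum]; ring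
      rw [this, hx]
      push_cast
      ring
  · rintro δ ⟨pδ, hδ⟩
    obtain ⟨u, hu⟩ := hδ 1 (one_mem _)
    obtain ⟨v, hv⟩ := hδ _ hσ
    obtain ⟨w, hw⟩ := hδ _ (pow_mem hσ 2)
    have hu' := htr (1 * δ)
    have hv' := htr ((((2 * a : ℤ) : ℚ⟮ρ⟯) - g) * δ)
    have hw' := htr ((((2 * a : ℤ) : ℚ⟮ρ⟯) - g) ^ 2 * δ)
    rw [hu] at hu'
    rw [hv] at hv'
    rw [hw] at hw'
    simp only [map_mul, map_sub, map_one, map_intCast, map_pow, hφ₁, hφ₂, hφ₃, one_mul]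
      at hu' hv' hw'
    push_cast at hu' hv' hw'
    have hfinal := aux_trace n a hn0 haR r₁ r₂ ρ (φ₁ δ) (φ₂ δ) (φ₃ δ) h₁ h₁' h₂ h₂' h₃ h₃' e₃
      (pδ φ₁.toRingHom) (pδ φ₂.toRingHom) (pδ φ₃.toRingHom) u v w hu' hv' hw'
    have hT := htr ((1 + (n : ℤ) * (((2 * a : ℤ) : ℚ⟮ρ⟯) - g)) * δ)
    simp only [map_add, map_mul, map_sub, map_one, map_intCast, hφ₁, hφ₂, hφ₃] at hT
    push_cast at hT
    have : ((n : ℚ) : ℝ) < ((Algebra.trace ℚ ℚ⟮ρ⟯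
        ((1 + (n : ℤ) * (((2 * a : ℤ) : ℚ⟮ρ⟯) - g)) * δ) : ℚ) : ℝ) := by
      push_cast
      rw [hT]
      rw [hu', hv'] at hfinal
      linarith
    exact_mod_cast this
end
end

section
/- Let a ≥ −1 be a rational integer, ρ the largest real root of x³ − ax² − (a+3)x − 1, and K = ℚ(ρ) the corresponding simplest cubic field; assume O_K = ℤ[ρ]. Write a = 3A + a₀ with A a nonnegative integer and a₀ ∈ {0,1,2}. If α is indecomposable in O_K, then N_{K/ℚ}(α) ≤ a² + 3a + 9 if a ≤ 3, and for a ≥ 4: N_{K/ℚ}(α) ≤ 3A⁴ + 14A³ + 28A² + 27A + 11 if a₀ = 2, N_{K/ℚ}(α) ≤ 3A⁴ + 10A³ + 16A² + 13A + 5 if a₀ = 1, and N_{K/ℚ}(α) ≤ 3A⁴ + 6A³ + 9A² + 6A + 3 if a₀ = 0. -/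
open IntermediateField

noncomputable section

/-- The norm form value at the triangle point with barycentric coordinates `v, s, t`. -/
def triNorm (v s t : ℤ) : ℤ :=
  (v + s + t + 3) * (v * s * t) + (s * v ^ 2 + s ^ 2 * t + t ^ 2 * v)
    + 3 * (v * s + s * t + t * v) + 2 * (v + s + t) + 3

lemma triNorm_rot (v s t : ℤ) : triNorm v s t = triNorm s t v := by
  unfold triNorm; ring

lemma tri_aux0 (k h j : ℤ) (hk : 0 ≤ k) (hh : 0 ≤ h) (hj2 : j ≤ 3 * h) :
    triNorm (k + (3 * h - j)) (k + j) k
      ≤ 3 * (k + h) ^ 4 + 6 * (k + h) ^ 3 + 9 * (k + h) ^ 2 + 6 * (k + h) + 3 := by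
  have c2 : 0 ≤ 9 * h ^ 2 - 9 * h * j + 3 * j ^ 2 := by nlinarith [sq_nonneg (3 * h - 2 * j)]
  have c1 : 0 ≤ h * (9 * h ^ 2 - 9 * h * j + 3 * j ^ 2) + 3 * h ^ 3
      + (9 * h ^ 2 - 9 * h * j + 3 * j ^ 2) := by positivity
  have c0 : 0 ≤ 3 * h ^ 4 + 6 * h * j ^ 2 - 9 * h ^ 2 * j + 6 * h ^ 3 - j ^ 3 - 9 * h * j
      + 9 * h ^ 2 + 3 * j ^ 2 := by
    have e : 0 ≤ (4 * h - j) * (h - j) ^ 2 := mul_nonneg (by linarith) (sq_nonneg _)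
    have e2 : 0 ≤ h ^ 3 := by positivity
    have e3 : 0 ≤ h ^ 4 := by positivity
    nlinarith
  have h1 := mul_nonneg hk c1
  have h2 := mul_nonneg (sq_nonneg k) c2
  unfold triNorm
  linarith

lemma tri_aux1 (k h j : ℤ) (hk : 0 ≤ k) (hh : 0 ≤ h) (hj : 0 ≤ j) (hj2 : j ≤ 3 * h + 1) :
    triNorm (k + (3 * h + 1 - j)) (k + j) k
      ≤ 3 * (k + h) ^ 4 + 10 * (k + h) ^ 3 + 16 * (k + h) ^ 2 + 13 * (k + h) + 5 := by
  rcases hh.eq_or_lt with rfl | hh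
  · obtain rfl | rfl : j = 0 ∨ j = 1 := by omega
    · unfold triNorm; nlinarith
    · unfold triNorm; nlinarith
  obtain ⟨m, rfl⟩ : ∃ m, h = m + 1 := ⟨h - 1, by ring⟩
  have hm : 0 ≤ m := by omega
  have c2 : 0 ≤ 3 * j ^ 2 - 9 * (m + 1) * j + 9 * (m + 1) ^ 2 + 6 * (m + 1) - 3 * j := by
    nlinarith [sq_nonneg (3 * (m + 1) + 1 - 2 * j)]
  have c1 : 0 ≤ 3 * (m + 1) * j ^ 2 - 9 * (m + 1) ^ 2 * j + 12 * (m + 1) ^ 3 - 15 * (m + 1) * j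
      + 21 * (m + 1) ^ 2 + 4 * j ^ 2 + 8 * (m + 1) - 4 * j := by
    have := mul_nonneg hm c2
    have e := mul_nonneg hm (sq_nonneg m)
    nlinarith [sq_nonneg (3 * (m + 1) + 1 - 2 * j)]
  have c0 : 0 ≤ 3 * (m + 1) ^ 4 + 6 * (m + 1) * j ^ 2 - 9 * (m + 1) ^ 2 * j + 10 * (m + 1) ^ 3
      - j ^ 3 - 15 * (m + 1) * j + 16 * (m + 1) ^ 2 + 5 * j ^ 2 + 7 * (m + 1) - 4 * j := by
    have e : 0 ≤ (4 * (m + 1) + 1 - j) * (m + 1 - j) ^ 2 :=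
      mul_nonneg (by linarith) (sq_nonneg _)
    have e2 : 0 ≤ m ^ 3 := by positivity
    have e3 : 0 ≤ m ^ 4 := by positivity
    nlinarith [sq_nonneg (3 * (m + 1) + 1 - 2 * j)]
  have h1 := mul_nonneg hk c1
  have h2 := mul_nonneg (sq_nonneg k) c2
  unfold triNorm
  linarith

lemma tri_aux2 (k h j : ℤ) (hk : 0 ≤ k) (hh : 0 ≤ h) (hj : 0 ≤ j) (hj2 : j ≤ 3 * h + 2) :
    triNorm (k + (3 * h + 2 - j)) (k + j) k
      ≤ 3 * (k + h) ^ 4 + 14 * (k + h) ^ 3 + 28 * (k + h) ^ 2 + 27 * (k + h) + 11 := by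
  rcases hh.eq_or_lt with rfl | hh
  · obtain rfl | rfl | rfl : j = 0 ∨ j = 1 ∨ j = 2 := by omega
    · unfold triNorm; nlinarith
    · unfold triNorm; nlinarith
    · unfold triNorm; nlinarith
  obtain ⟨m, rfl⟩ : ∃ m, h = m + 1 := ⟨h - 1, by ring⟩
  have hm : 0 ≤ m := by omega
  have c2 : 0 ≤ 3 * j ^ 2 - 9 * (m + 1) * j + 9 * (m + 1) ^ 2 + 12 * (m + 1) - 6 * j + 3 := by
    nlinarith [sq_nonneg (3 * (m + 1) + 2 - 2 * j)]
  have c1 : 0 ≤ 3 * (m + 1) * j ^ 2 - 9 * (m + 1) ^ 2 * j + 12 * (m + 1) ^ 3 - 21 * (m + 1) * j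
      + 33 * (m + 1) ^ 2 + 5 * j ^ 2 + 26 * (m + 1) - 10 * j + 5 := by
    have := mul_nonneg hm c2
    have e := mul_nonneg hm (sq_nonneg m)
    nlinarith [sq_nonneg (3 * (m + 1) + 2 - 2 * j)]
  have c0 : 0 ≤ 3 * (m + 1) ^ 4 + 6 * (m + 1) * j ^ 2 - 9 * (m + 1) ^ 2 * j + 14 * (m + 1) ^ 3
      - j ^ 3 - 21 * (m + 1) * j + 28 * (m + 1) ^ 2 + 7 * j ^ 2 + 21 * (m + 1) - 10 * j + 4 := by
    have e : 0 ≤ (4 * (m + 1) + 2 - j) * (m + 1 - j) ^ 2 :=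
      mul_nonneg (by linarith) (sq_nonneg _)
    have e2 : 0 ≤ m ^ 3 := by positivity
    have e3 : 0 ≤ m ^ 4 := by positivity
    nlinarith [sq_nonneg (3 * (m + 1) + 2 - 2 * j)]
  have h1 := mul_nonneg hk c1
  have h2 := mul_nonneg (sq_nonneg k) c2
  unfold triNorm
  linarith

/-- The three bounds, uniformly, when `t` is the least coordinate. -/
lemma tri_bound_min (A v s t : ℤ) (ht : 0 ≤ t) (hv : t ≤ v) (hs : t ≤ s) :
    (v + s + t = 3 * A → triNorm v s t ≤ 3 * A ^ 4 + 6 * A ^ 3 + 9 * A ^ 2 + 6 * A + 3) ∧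
    (v + s + t = 3 * A + 1 → triNorm v s t ≤ 3 * A ^ 4 + 10 * A ^ 3 + 16 * A ^ 2 + 13 * A + 5) ∧
    (v + s + t = 3 * A + 2 →
      triNorm v s t ≤ 3 * A ^ 4 + 14 * A ^ 3 + 28 * A ^ 2 + 27 * A + 11) := by
  refine ⟨fun h => ?_, fun h => ?_, fun h => ?_⟩
  · have := tri_aux0 t (A - t) (s - t) ht (by omega) (by omega)
    convert this using 2 <;> first | omega | ring_nf
  · have := tri_aux1 t (A - t) (s - t) ht (by omega) (by omega) (by omega)
    convert this using 2 <;> first | omega | ring_nf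
  · have := tri_aux2 t (A - t) (s - t) ht (by omega) (by omega) (by omega)
    convert this using 2 <;> first | omega | ring_nf

lemma tri_bound (A v s t : ℤ) (hv : 0 ≤ v) (hs : 0 ≤ s) (ht : 0 ≤ t) :
    (v + s + t = 3 * A → triNorm v s t ≤ 3 * A ^ 4 + 6 * A ^ 3 + 9 * A ^ 2 + 6 * A + 3) ∧
    (v + s + t = 3 * A + 1 → triNorm v s t ≤ 3 * A ^ 4 + 10 * A ^ 3 + 16 * A ^ 2 + 13 * A + 5) ∧
    (v + s + t = 3 * A + 2 →
      triNorm v s t ≤ 3 * A ^ 4 + 14 * A ^ 3 + 28 * A ^ 2 + 27 * A + 11) := by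
  have key : (t ≤ v ∧ t ≤ s) ∨ (v ≤ s ∧ v ≤ t) ∨ (s ≤ t ∧ s ≤ v) := by omega
  rcases key with ⟨h1, h2⟩ | ⟨h1, h2⟩ | ⟨h1, h2⟩
  · exact tri_bound_min A v s t ht h1 h2
  · have := tri_bound_min A s t v hv h1 h2
    rw [triNorm_rot v s t, show v + s + t = s + t + v by ring]
    exact this
  · have := tri_bound_min A t v s hs h1 h2
    rw [← triNorm_rot t v s, show v + s + t = t + v + s by ring]
    exact this

/-- The element `x + y g + z g²`. -/
def el {K : Type*} [Field K] (g : K) (x y z : ℤ) : K := (x : K) + y * g + z * g ^ 2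

lemma el_mul {K : Type*} [Field K] (a : ℤ) (g : K)
    (hg : g ^ 3 = a * g ^ 2 + (a + 3) * g + 1) (x y z x' y' z' : ℤ) :
    el g x y z * el g x' y' z' =
      el g (x * x' + (y * z' + z * y') + z * z' * a)
        (x * y' + y * x' + (y * z' + z * y') * (a + 3) + z * z' * (1 + a * (a + 3)))
        (x * z' + y * y' + z * x' + (y * z' + z * y') * a + z * z' * (a ^ 2 + a + 3)) := by
  unfold el
  push_cast
  linear_combination ((y : K) * z' + z * y' + z * z' * (g + a)) * hg

lemma el_add {K : Type*} [Field K] (g : K) (x y z x' y' z' : ℤ) :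
    el g x y z + el g x' y' z' = el g (x + x') (y + y') (z + z') := by
  unfold el; push_cast; ring

/-- The norm form. -/
def nf (a x y z : ℤ) : ℤ :=
  -a^2*x*y*z + a^2*x*z^2 + a^2*x^2*z - 3*a*x*y*z - a*x*y^2 + 4*a*x*z^2 + a*x^2*y + 2*a*x^2*z
    - a*y*z^2 + a*y^2*z - 3*x*y*z - 3*x*y^2 + 9*x*z^2 + 6*x^2*z + x^3 - 3*y*z^2 + y^3 + z^3

lemma root_ne {a r : ℝ} (hr : r ^ 3 = a * r ^ 2 + (a + 3) * r + 1) : r ≠ 0 ∧ 1 + r ≠ 0 := by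
  constructor
  · rintro rfl; norm_num at hr
  · intro h
    have : r = -1 := by linarith
    subst this; norm_num at hr

lemma map_el {K : Type*} [Field K] (g : K) (φ : K →+* ℝ) (x y z : ℤ) :
    φ (el g x y z) = x + y * φ g + z * φ g ^ 2 := by
  simp [el]

lemma pos_comb {p q r A B C : ℝ} (hp : 0 < p) (hq : 0 < q) (hr : 0 < r) (hA : 0 ≤ A)
    (hB : 0 ≤ B) (hC : 0 ≤ C) (h : ¬ (A = 0 ∧ B = 0 ∧ C = 0)) : 0 < A * p + B * q + C * r := by
  have h1 := mul_nonneg hA hp.le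
  have h2 := mul_nonneg hB hq.le
  have h3 := mul_nonneg hC hr.le
  by_contra hn
  apply h
  refine ⟨?_, ?_, ?_⟩
  · have : A * p = 0 := by linarith
    simpa [hp.ne'] using this
  · have : B * q = 0 := by linarith
    simpa [hq.ne'] using this
  · have : C * r = 0 := by linarith
    simpa [hr.ne'] using this

section core
variable {K : Type*} [Field K] (a : ℤ) (g : K)

lemma map_root (hg : g ^ 3 = a * g ^ 2 + (a + 3) * g + 1) (φ : K →+* ℝ) :
    φ g ^ 3 = a * φ g ^ 2 + (a + 3) * φ g + 1 := by
  have h3 : φ 3 = 3 := map_ofNat φ 3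
  have := congrArg φ hg
  simpa [h3] using this

lemma cone1_pos (hg : g ^ 3 = a * g ^ 2 + (a + 3) * g + 1) (x y z : ℤ)
    (h1 : 0 ≤ 2 * x - y) (h2 : 0 ≤ 2 * z - y) (h3 : 0 ≤ y)
    (h : ¬ (x = 0 ∧ y = 0 ∧ z = 0)) : TotallyPositive (el g x y z) := by
  intro φ
  obtain ⟨hr0, hr1⟩ := root_ne (map_root a g hg φ)
  rw [map_el]
  have := pos_comb (p := 1) (q := φ g ^ 2) (r := (1 + φ g) ^ 2) one_pos (by positivity)
    (by positivity) (A := ((2 * x - y : ℤ) : ℝ)) (B := ((2 * z - y : ℤ) : ℝ)) (C := (y : ℝ))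
    (by exact_mod_cast h1) (by exact_mod_cast h2) (by exact_mod_cast h3)
    (by norm_cast; omega)
  push_cast at this
  nlinarith

lemma cone2_pos (ha : 0 ≤ a) (hg : g ^ 3 = a * g ^ 2 + (a + 3) * g + 1) (x y z : ℤ)
    (h1 : 0 ≤ (a ^ 2 + 3 * a + 3) * x - (a + 1) * y)
    (h2 : 0 ≤ (a ^ 2 + 3 * a + 3) * z + (a + 2) * y) (h3 : 0 ≤ -y)
    (h : ¬ (x = 0 ∧ y = 0 ∧ z = 0)) : TotallyPositive (el g x y z) := by
  intro φ
  have hr := map_root a g hg φ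
  obtain ⟨hr0, hr1⟩ := root_ne hr
  rw [map_el]
  set r := φ g
  have hD : (0 : ℝ) < (a : ℝ) ^ 2 + 3 * a + 3 := by
    have : (0 : ℝ) ≤ a := by exact_mod_cast ha
    positivity
  have hDz : a ^ 2 + 3 * a + 3 ≠ 0 := by positivity
  have hu : r * (2 + (a + 1) * r - r ^ 2) ≠ 0 := by
    refine mul_ne_zero hr0 ?_
    intro h0
    have : (1 + r) * (2 + (a + 1) * r - r ^ 2) = 1 := by linear_combination -hr
    rw [h0] at this
    simp at this
  have := pos_comb (p := 1) (q := r ^ 2) (r := (r * (2 + (a + 1) * r - r ^ 2)) ^ 2) one_pos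
    (by positivity) (by positivity)
    (A := (((a ^ 2 + 3 * a + 3) * x - (a + 1) * y : ℤ) : ℝ))
    (B := (((a ^ 2 + 3 * a + 3) * z + (a + 2) * y : ℤ) : ℝ)) (C := ((-y : ℤ) : ℝ))
    (by exact_mod_cast h1) (by exact_mod_cast h2) (by exact_mod_cast h3)
    (by
      norm_cast
      rintro ⟨e1, e2, e3⟩
      have hy : y = 0 := by omega
      subst hy
      simp [hDz] at e1 e2
      exact h ⟨e1, rfl, e2⟩)
  have hu1 : r * (2 + (a + 1) * r - r ^ 2) = r ^ 2 - (a + 1) * r - 1 := by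
    linear_combination -hr
  have hu2 : (r ^ 2 - (a + 1) * r - 1) ^ 2
      = -(a + 1) - (a ^ 2 + 3 * a + 3) * r + (a + 2) * r ^ 2 := by
    linear_combination (r - a - 2) * hr
  rw [hu1, hu2] at this
  push_cast at this
  have h' : 0 < ((a : ℝ) ^ 2 + 3 * a + 3) * (x + y * r + z * r ^ 2) := by
    nlinarith
  exact (pos_iff_pos_of_mul_pos h').1 hD

variable (O : Subalgebra ℤ K)

lemma indec_unit {α s s' : K} (hα : IsIndecomposableIn O α) (hs : s ∈ O) (hs' : s' ∈ O)
    (h : s * s' = 1) : IsIndecomposableIn O (α * (s * s)) := by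
  obtain ⟨h1, h2, h3⟩ := hα
  have tp : ∀ (u u' : K), u * u' = 1 → ∀ β, TotallyPositive β → TotallyPositive (β * (u * u)) := by
    intro u u' hu β hβ φ
    have hne : φ u ≠ 0 := by
      intro h0
      have := congrArg φ hu
      simp [h0] at this
    rw [map_mul, map_mul]
    exact mul_pos (hβ φ) (mul_self_pos.2 hne)
  refine ⟨O.mul_mem h1 (O.mul_mem hs hs), tp s s' h α h2, ?_⟩
  rintro ⟨β, γ, hβ, hγ, pβ, pγ, e⟩
  apply h3
  refine ⟨β * (s' * s'), γ * (s' * s'), O.mul_mem hβ (O.mul_mem hs' hs'),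
    O.mul_mem hγ (O.mul_mem hs' hs'), tp s' s (by rw [mul_comm]; exact h) β pβ,
    tp s' s (by rw [mul_comm]; exact h) γ pγ, ?_⟩
  rw [← add_mul, ← e]
  linear_combination -α * (s * s' + 1) * h

/-- The coordinates of the two relevant kinds of reduced indecomposables. -/
lemma core [Algebra ℚ K] (ha : 0 ≤ a) (hg : g ^ 3 = a * g ^ 2 + (a + 3) * g + 1)
    (hO : ∀ α, α ∈ O ↔ ∃ x y z : ℤ, α = el g x y z)
    (hN : ∀ x y z : ℤ, Algebra.norm ℚ (el g x y z) = (nf a x y z : ℤ))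
    (hpos : ∀ x y z : ℤ, TotallyPositive (el g x y z) → 0 ≤ 2 * x + 2 * z - y ∧ 0 ≤ 2 * x + 2 * z)
    (hpos0 : ¬ TotallyPositive (0 : K))
    (α : K) (hα : IsIndecomposableIn O α) :
    ∃ n : ℤ, Algebra.norm ℚ α = (n : ℚ) ∧ (n = 1 ∨ n = a ^ 2 + 3 * a + 9 ∨
      ∃ v s t : ℤ, 0 ≤ v ∧ 0 ≤ s ∧ 0 ≤ t ∧ v + s + t = a ∧ n = triNorm v s t) := by
  have elO : ∀ x y z : ℤ, el g x y z ∈ O := fun x y z => (hO _).2 ⟨x, y, z, rfl⟩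
  -- closure under units
  have step : ∀ x y z p q r p' q' r' : ℤ, el g p q r * el g p' q' r' = 1 → nf a p q r ^ 2 = 1 →
      IsIndecomposableIn O (el g x y z) →
      IsIndecomposableIn O (el g x y z * (el g p q r * el g p q r)) ∧
      Algebra.norm ℚ (el g x y z * (el g p q r * el g p q r)) = Algebra.norm ℚ (el g x y z) := by
    intro x y z p q r p' q' r' h1 h2 h3
    refine ⟨indec_unit O h3 (elO _ _ _) (elO _ _ _) h1, ?_⟩
    rw [map_mul, map_mul, hN p q r, ← pow_two]
    have : ((nf a p q r : ℤ) : ℚ) ^ 2 = 1 := by exact_mod_cast h2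
    rw [this, mul_one]
  classical
  let P : ℕ → Prop := fun n => ∃ x y z : ℤ, IsIndecomposableIn O (el g x y z) ∧
    Algebra.norm ℚ (el g x y z) = Algebra.norm ℚ α ∧
    (2 * x + 2 * z - y = n ∨ 2 * x + 2 * z = n)
  have hex : ∃ n, P n := by
    obtain ⟨x, y, z, rfl⟩ := (hO α).1 hα.1
    exact ⟨(2 * x + 2 * z).toNat, x, y, z, hα, rfl,
      Or.inr (by rw [Int.toNat_of_nonneg (hpos x y z hα.2.1).2])⟩
  obtain ⟨x, y, z, hI, hn, hmin⟩ := Nat.find_spec hex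
  have hle : ∀ x' y' z' : ℤ, IsIndecomposableIn O (el g x' y' z') →
      Algebra.norm ℚ (el g x' y' z') = Algebra.norm ℚ (el g x y z) →
      (Nat.find hex : ℤ) ≤ 2 * x' + 2 * z' - y' ∧ (Nat.find hex : ℤ) ≤ 2 * x' + 2 * z' := by
    intro x' y' z' h1 h2
    obtain ⟨p1, p2⟩ := hpos x' y' z' h1.2.1
    have q1 : Nat.find hex ≤ (2 * x' + 2 * z' - y').toNat :=
      Nat.find_min' hex ⟨x', y', z', h1, h2.trans hn, Or.inl (by omega)⟩
    have q2 : Nat.find hex ≤ (2 * x' + 2 * z').toNat :=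
      Nat.find_min' hex ⟨x', y', z', h1, h2.trans hn, Or.inr (by omega)⟩
    omega
  generalize Nat.find hex = m at hmin hle
  have h0 := hle x y z hI rfl
  have indec : ∀ p q r : ℤ, TotallyPositive (el g p q r) →
      TotallyPositive (el g (x - p) (y - q) (z - r)) → False := by
    intro p q r h1 h2
    exact hI.2.2 ⟨_, _, elO _ _ _, elO _ _ _, h1, h2, by rw [el_add]; congr 1 <;> ring⟩
  have hne : ¬ (x = 0 ∧ y = 0 ∧ z = 0) := by
    rintro ⟨rfl, rfl, rfl⟩
    have := hI.2.1
    simp [el] at this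
    exact hpos0 this
  refine ⟨nf a x y z, by rw [← hn, hN], ?_⟩
  have one_eq : el g 1 0 0 = 1 := by simp [el]
  rcases hmin with hmin | hmin
  · -- first cone
    have hy : 0 ≤ y := by linarith [h0.2]
    obtain ⟨s1, s2⟩ := step x y z (-1) (-(a + 1)) 1 (-a - 2) (-a) 1
      (by rw [el_mul a g hg, ← one_eq]; congr 1 <;> ring) (by unfold nf; ring) hI
    obtain ⟨s3, s4⟩ := step x y z 2 (a + 1) (-1) 1 1 0
      (by rw [el_mul a g hg, ← one_eq]; congr 1 <;> ring) (by unfold nf; ring) hI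
    rw [el_mul a g hg, el_mul a g hg] at s1 s2 s3 s4
    have l1 := (hle _ _ _ s1 s2).2
    have l2 := (hle _ _ _ s3 s4).2
    have hz : 0 ≤ 2 * z - y := by linarith
    have hx : 0 ≤ 2 * x - y := by linarith
    clear l1 l2 s1 s2 s3 s4
    by_cases e1 : x = 1 ∧ y = 0 ∧ z = 0
    · left; obtain ⟨rfl, rfl, rfl⟩ := e1; unfold nf; ring
    by_cases e2 : x = 0 ∧ y = 0 ∧ z = 1
    · left; obtain ⟨rfl, rfl, rfl⟩ := e2; unfold nf; ring
    by_cases e3 : x = 1 ∧ y = 2 ∧ z = 1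
    · left; obtain ⟨rfl, rfl, rfl⟩ := e3; unfold nf; ring
    have t1 : 2 * x - y < 2 := by
      by_contra hc
      exact indec 1 0 0 (cone1_pos a g hg _ _ _ (by omega) (by omega) (by omega) (by omega))
        (cone1_pos a g hg _ _ _ (by omega) (by omega) (by omega) (by omega))
    have t2 : 2 * z - y < 2 := by
      by_contra hc
      exact indec 0 0 1 (cone1_pos a g hg _ _ _ (by omega) (by omega) (by omega) (by omega))
        (cone1_pos a g hg _ _ _ (by omega) (by omega) (by omega) (by omega))
    have t3 : y < 2 := by
      by_contra hc
      exact indec 1 2 1 (cone1_pos a g hg _ _ _ (by omega) (by omega) (by omega) (by omega))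
        (cone1_pos a g hg _ _ _ (by omega) (by omega) (by omega) (by omega))
    obtain ⟨rfl, rfl, rfl⟩ : x = 1 ∧ y = 1 ∧ z = 1 := by omega
    right; left; unfold nf; ring
  · -- second cone
    have hy : 0 ≤ -y := by linarith [h0.1]
    obtain ⟨s1, s2⟩ := step x y z (-a - 2) (-a) 1 (-1) (-(a + 1)) 1
      (by rw [el_mul a g hg, ← one_eq]; congr 1 <;> ring) (by unfold nf; ring) hI
    obtain ⟨s3, s4⟩ := step x y z 1 1 0 2 (a + 1) (-1)
      (by rw [el_mul a g hg, ← one_eq]; congr 1 <;> ring) (by unfold nf; ring) hI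
    rw [el_mul a g hg, el_mul a g hg] at s1 s2 s3 s4
    have l1 := (hle _ _ _ s1 s2).1
    have l2 := (hle _ _ _ s3 s4).1
    have hx : 0 ≤ (a ^ 2 + 3 * a + 3) * x - (a + 1) * y := by linarith
    have hz : 0 ≤ (a ^ 2 + 3 * a + 3) * z + (a + 2) * y := by linarith
    clear l1 l2 s1 s2 s3 s4
    have hD : 0 < a ^ 2 + 3 * a + 3 := by positivity
    by_cases e1 : x = 1 ∧ y = 0 ∧ z = 0
    · left; obtain ⟨rfl, rfl, rfl⟩ := e1; unfold nf; ring
    by_cases e2 : x = 0 ∧ y = 0 ∧ z = 1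
    · left; obtain ⟨rfl, rfl, rfl⟩ := e2; unfold nf; ring
    by_cases e3 : x = -(a + 1) ∧ y = -(a ^ 2 + 3 * a + 3) ∧ z = a + 2
    · left; obtain ⟨rfl, rfl, rfl⟩ := e3; unfold nf; ring
    have t1 : (a ^ 2 + 3 * a + 3) * x - (a + 1) * y < a ^ 2 + 3 * a + 3 := by
      by_contra hc
      exact indec 1 0 0
        (cone2_pos a g ha hg _ _ _ (by nlinarith) (by nlinarith) (by omega) (by omega))
        (cone2_pos a g ha hg _ _ _ (by linarith) (by linarith) (by linarith) (by omega))
    have t2 : (a ^ 2 + 3 * a + 3) * z + (a + 2) * y < a ^ 2 + 3 * a + 3 := by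
      by_contra hc
      exact indec 0 0 1
        (cone2_pos a g ha hg _ _ _ (by nlinarith) (by nlinarith) (by omega) (by omega))
        (cone2_pos a g ha hg _ _ _ (by linarith) (by linarith) (by linarith) (by omega))
    have t3 : -y < a ^ 2 + 3 * a + 3 := by
      by_contra hc
      exact indec (-(a + 1)) (-(a ^ 2 + 3 * a + 3)) (a + 2)
        (cone2_pos a g ha hg _ _ _ (by linarith) (by linarith) (by linarith) (by omega))
        (cone2_pos a g ha hg _ _ _ (by linarith) (by linarith) (by linarith) (by omega))
    have lev0 : 0 < x + z := by
      by_contra hc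
      have e : (a ^ 2 + 3 * a + 3) * (x + z) ≤ 0 :=
        mul_nonpos_of_nonneg_of_nonpos hD.le (by omega)
      have y0 : y = 0 := by linarith
      subst y0
      have x0 : 0 ≤ x := by
        by_contra hh
        nlinarith
      have z0 : 0 ≤ z := by
        by_contra hh
        nlinarith
      omega
    have lev3 : x + z < 3 := by
      by_contra hc
      nlinarith
    obtain hl | hl : x + z = 1 ∨ x + z = 2 := by omega
    · -- level one
      right; right
      obtain ⟨v, rfl⟩ : ∃ v, x = -v := ⟨-x, by ring⟩
      obtain ⟨r, rfl⟩ : ∃ r, y = -(v * (a + 2) + r) := ⟨-y - v * (a + 2), by ring⟩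
      obtain rfl : z = v + 1 := by omega
      have k1 : v ≤ (a + 1) * r := by linarith
      have k2 : (a + 1) * v + (a + 2) * r ≤ a ^ 2 + 3 * a + 3 := by linarith
      have k3 : 0 ≤ v * (a + 2) + r := by linarith
      have k4 : (a + 1) * r < v + (a ^ 2 + 3 * a + 3) := by linarith
      have k5 : 0 < (a + 1) * v + (a + 2) * r := by linarith
      have k6 : v * (a + 2) + r < a ^ 2 + 3 * a + 3 := by linarith
      have hr : 1 ≤ r := by
        by_contra hc
        have : (a ^ 2 + 3 * a + 3) * r ≤ 0 :=
          mul_nonpos_of_nonneg_of_nonpos hD.le (by omega)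
        nlinarith
      have hv : 0 ≤ v := by
        have : 0 < (a ^ 2 + 3 * a + 3) * (v + 1) := by nlinarith
        have := (pos_iff_pos_of_mul_pos this).1 hD
        omega
      have ht : 0 ≤ a + 1 - v - r := by
        have : 0 < (a ^ 2 + 3 * a + 3) * (a + 2 - v - r) := by nlinarith
        have := (pos_iff_pos_of_mul_pos this).1 hD
        omega
      refine ⟨v, r - 1, a + 1 - v - r, hv, by omega, ht, by ring, ?_⟩
      unfold nf triNorm
      ring
    · -- level two: decomposable
      exfalso
      obtain ⟨v, rfl⟩ : ∃ v, x = -v := ⟨-x, by ring⟩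
      obtain ⟨r, rfl⟩ : ∃ r, y = -(v * (a + 2) + r) := ⟨-y - v * (a + 2), by ring⟩
      obtain rfl : z = v + 2 := by omega
      have k1 : v ≤ (a + 1) * r := by linarith
      have k2 : (a + 1) * v + (a + 2) * r ≤ 2 * (a ^ 2 + 3 * a + 3) := by linarith
      have k3 : 0 ≤ v * (a + 2) + r := by linarith
      have k4 : (a + 1) * r < v + (a ^ 2 + 3 * a + 3) := by linarith
      have k5 : a ^ 2 + 3 * a + 3 < (a + 1) * v + (a + 2) * r := by linarith
      have k6 : v * (a + 2) + r < a ^ 2 + 3 * a + 3 := by linarith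
      have hr : 2 ≤ r := by
        have : 0 < (a ^ 2 + 3 * a + 3) * (r - 1) := by nlinarith
        have := (pos_iff_pos_of_mul_pos this).1 hD
        omega
      have hv : 0 ≤ v := by
        have : 0 < (a ^ 2 + 3 * a + 3) * (v + 1) := by nlinarith
        have := (pos_iff_pos_of_mul_pos this).1 hD
        omega
      have ht : 0 ≤ 2 * (a + 1) - v - r := by
        have : 0 < (a ^ 2 + 3 * a + 3) * (2 * (a + 1) - v - r + 1) := by nlinarith
        have := (pos_iff_pos_of_mul_pos this).1 hD
        omega
      -- points of the level one triangle are totally positive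
      have tri : ∀ v' r' : ℤ, 0 ≤ v' → 1 ≤ r' → v' + r' ≤ a + 1 →
          TotallyPositive (el g (-v') (-(v' * (a + 2) + r')) (v' + 1)) := by
        intro v' r' q1 q2 q3
        refine cone2_pos a g ha hg _ _ _ (by nlinarith) (by nlinarith) (by nlinarith) (by omega)
      -- splitting
      obtain ⟨v', r', q1, q2, q3, q4, q5, q6⟩ : ∃ v' r' : ℤ, 0 ≤ v' ∧ 1 ≤ r' ∧ v' + r' ≤ a + 1 ∧
          0 ≤ v - v' ∧ 1 ≤ r - r' ∧ (v - v') + (r - r') ≤ a + 1 := by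
        by_cases hva : v ≤ a
        · by_cases hvr : v + r ≤ a + 2
          · exact ⟨v, 1, by omega⟩
          · exact ⟨v, a + 1 - v, by omega⟩
        · exact ⟨a, 1, by omega⟩
      refine indec _ _ _ (tri v' r' q1 q2 q3) ?_
      convert tri (v - v') (r - r') q4 q5 q6 using 2 <;> ring

end core

lemma gen_root (a : ℤ) (ρ : ℝ)
    (hroot : ρ ^ 3 - (a : ℝ) * ρ ^ 2 - ((a : ℝ) + 3) * ρ - 1 = 0) :
    (AdjoinSimple.gen ℚ ρ) ^ 3 = (a : ℚ⟮ρ⟯) * (AdjoinSimple.gen ℚ ρ) ^ 2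
      + (a + 3) * AdjoinSimple.gen ℚ ρ + 1 := by
  apply Subtype.ext
  push_cast
  simp only [AdjoinSimple.coe_gen]
  have h3 : ((3 : ℚ⟮ρ⟯) : ℝ) = 3 := rfl
  linear_combination hroot + ρ * h3.symm

lemma mem_iff_el {K : Type*} [Field K] (a : ℤ) (g : K)
    (hg : g ^ 3 = a * g ^ 2 + (a + 3) * g + 1) (O : Subalgebra ℤ K)
    (hO : O = Algebra.adjoin ℤ {g}) (α : K) : α ∈ O ↔ ∃ x y z : ℤ, α = el g x y z := by
  subst hO
  constructor
  · intro h
    induction h using Algebra.adjoin_induction with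
    | mem x hx =>
      rw [Set.mem_singleton_iff] at hx
      exact ⟨0, 1, 0, by simp [el, hx]⟩
    | algebraMap r => exact ⟨r, 0, 0, by simp [el]⟩
    | add p q _ _ hp hq =>
      obtain ⟨x, y, z, rfl⟩ := hp
      obtain ⟨x', y', z', rfl⟩ := hq
      exact ⟨_, _, _, el_add g x y z x' y' z'⟩
    | mul p q _ _ hp hq =>
      obtain ⟨x, y, z, rfl⟩ := hp
      obtain ⟨x', y', z', rfl⟩ := hq
      exact ⟨_, _, _, el_mul a g hg x y z x' y' z'⟩
  · rintro ⟨x, y, z, rfl⟩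
    have hgm : g ∈ Algebra.adjoin ℤ {g} := Algebra.subset_adjoin rfl
    have hi : ∀ n : ℤ, (n : K) ∈ Algebra.adjoin ℤ {g} := fun n => by
      simp
    unfold el
    exact add_mem (add_mem (hi x) (mul_mem (hi y) hgm)) (mul_mem (hi z) (pow_mem hgm 2))

open Polynomial in
/-- The simplest cubic polynomial over `ℚ`. -/
def cubicPoly (a : ℤ) : ℚ[X] := X ^ 3 - C (a : ℚ) * X ^ 2 - C ((a : ℚ) + 3) * X - 1

open Polynomial in
lemma cubicPoly_natDegree (a : ℤ) : (cubicPoly a).natDegree = 3 := by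
  unfold cubicPoly; compute_degree!

open Polynomial in
lemma cubicPoly_monic (a : ℤ) : (cubicPoly a).Monic := by
  unfold cubicPoly; monicity!

open Polynomial in
lemma cubicPoly_aeval (a : ℤ) (r : ℝ) :
    aeval r (cubicPoly a) = r ^ 3 - (a : ℝ) * r ^ 2 - ((a : ℝ) + 3) * r - 1 := by
  simp [cubicPoly]

lemma isIntegral_root (a : ℤ) (ρ : ℝ)
    (hroot : ρ ^ 3 - (a : ℝ) * ρ ^ 2 - ((a : ℝ) + 3) * ρ - 1 = 0) : IsIntegral ℚ ρ := by
  refine ⟨cubicPoly a, cubicPoly_monic a, ?_⟩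
  have := cubicPoly_aeval a ρ
  rw [hroot] at this
  exact this

lemma minpoly_root (a : ℤ) (ρ : ℝ)
    (hroot : ρ ^ 3 - (a : ℝ) * ρ ^ 2 - ((a : ℝ) + 3) * ρ - 1 = 0)
    (hdeg : Module.finrank ℚ ℚ⟮ρ⟯ = 3) : minpoly ℚ ρ = cubicPoly a := by
  have hi := isIntegral_root a ρ hroot
  have h1 : (minpoly ℚ ρ).natDegree = 3 := by
    rw [← hdeg]; exact (adjoin.finrank hi).symm
  have h2 : minpoly ℚ ρ ∣ cubicPoly a := minpoly.dvd _ _ (by rw [cubicPoly_aeval, hroot])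
  exact (Polynomial.eq_of_monic_of_dvd_of_natDegree_le (minpoly.monic hi) (cubicPoly_monic a) h2
    (by rw [cubicPoly_natDegree, h1])).symm

lemma exists_embedding (a : ℤ) (ρ : ℝ)
    (hroot : ρ ^ 3 - (a : ℝ) * ρ ^ 2 - ((a : ℝ) + 3) * ρ - 1 = 0)
    (hdeg : Module.finrank ℚ ℚ⟮ρ⟯ = 3) (r : ℝ)
    (hr : r ^ 3 - (a : ℝ) * r ^ 2 - ((a : ℝ) + 3) * r - 1 = 0) :
    ∃ φ : ℚ⟮ρ⟯ →+* ℝ, φ (AdjoinSimple.gen ℚ ρ) = r := by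
  have hi := isIntegral_root a ρ hroot
  have h : Polynomial.aeval r (minpoly ℚ (adjoin.powerBasis hi).gen) = 0 := by
    have hm : minpoly ℚ (AdjoinSimple.gen ℚ ρ) = minpoly ℚ ρ := by
      have := minpoly.algebraMap_eq (A := ℚ) (B := ℚ⟮ρ⟯) (B' := ℝ)
        (algebraMap ℚ⟮ρ⟯ ℝ).injective (AdjoinSimple.gen ℚ ρ)
      rw [← this, AdjoinSimple.algebraMap_gen]
    rw [adjoin.powerBasis_gen, hm, minpoly_root a ρ hroot hdeg, cubicPoly_aeval, hr]
  refine ⟨((adjoin.powerBasis hi).lift r h : ℚ⟮ρ⟯ →ₐ[ℚ] ℝ).toRingHom, ?_⟩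
  have := (adjoin.powerBasis hi).lift_gen r h
  rw [adjoin.powerBasis_gen] at this
  exact this

lemma functionals_nonneg (a : ℤ) (ρ : ℝ)
    (hroot : ρ ^ 3 - (a : ℝ) * ρ ^ 2 - ((a : ℝ) + 3) * ρ - 1 = 0)
    (hdeg : Module.finrank ℚ ℚ⟮ρ⟯ = 3) (x y z : ℤ)
    (h : TotallyPositive (el (AdjoinSimple.gen ℚ ρ) x y z)) :
    0 ≤ 2 * x + 2 * z - y ∧ 0 ≤ 2 * x + 2 * z := by
  obtain ⟨hr0, hr1⟩ := root_ne (a := a) (r := ρ) (by linarith)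
  have key : ∀ r : ℝ, r ^ 3 - (a : ℝ) * r ^ 2 - ((a : ℝ) + 3) * r - 1 = 0 →
      0 < x + y * r + z * r ^ 2 := by
    intro r hr
    obtain ⟨φ, hφ⟩ := exists_embedding a ρ hroot hdeg r hr
    have := h φ
    rwa [map_el, hφ] at this
  have k1 := key ρ hroot
  have k2 := key (-(1 + ρ) / ρ) (by
    field_simp
    linear_combination hroot)
  have k3 := key (-1 / (1 + ρ)) (by
    field_simp
    linear_combination (-1 : ℝ) * hroot)
  have p2 : 0 < x * ρ ^ 2 - y * (ρ * (1 + ρ)) + z * (1 + ρ) ^ 2 := by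
    have : 0 < ρ ^ 2 * (x + y * (-(1 + ρ) / ρ) + z * (-(1 + ρ) / ρ) ^ 2) := by positivity
    convert this using 1
    field_simp
    ring
  have p3 : 0 < x * (1 + ρ) ^ 2 - y * (1 + ρ) + z := by
    have : 0 < (1 + ρ) ^ 2 * (x + y * (-1 / (1 + ρ)) + z * (-1 / (1 + ρ)) ^ 2) := by positivity
    convert this using 1
    field_simp
    ring
  have hT : 0 < ρ ^ 2 + ρ + 1 := by nlinarith [sq_nonneg (2 * ρ + 1)]
  have hU : 0 < (1 + ρ) ^ 2 + ρ ^ 2 + ρ ^ 2 * (1 + ρ) ^ 2 := by positivity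
  constructor
  · have : 0 < (ρ ^ 2 + ρ + 1) * (2 * x + 2 * z - y : ℝ) := by nlinarith
    have := (pos_iff_pos_of_mul_pos this).1 hT
    exact_mod_cast this.le
  · have q1 : 0 < (1 + ρ) ^ 2 * (x + y * ρ + z * ρ ^ 2) := by positivity
    have q3 : 0 < ρ ^ 2 * (x * (1 + ρ) ^ 2 - y * (1 + ρ) + z) := by positivity
    have : 0 < ((1 + ρ) ^ 2 + ρ ^ 2 + ρ ^ 2 * (1 + ρ) ^ 2) * (2 * x + 2 * z : ℝ) := by nlinarith
    have := (pos_iff_pos_of_mul_pos this).1 hU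
    exact_mod_cast this.le

lemma norm_el (a : ℤ) (ρ : ℝ)
    (hroot : ρ ^ 3 - (a : ℝ) * ρ ^ 2 - ((a : ℝ) + 3) * ρ - 1 = 0)
    (hdeg : Module.finrank ℚ ℚ⟮ρ⟯ = 3) (x y z : ℤ) :
    Algebra.norm ℚ (el (AdjoinSimple.gen ℚ ρ) x y z) = (nf a x y z : ℤ) := by
  have hi := isIntegral_root a ρ hroot
  have hg := gen_root a ρ hroot
  have hdim : (adjoin.powerBasis hi).dim = 3 := by
    rw [← PowerBasis.finrank, hdeg]
  let b : Module.Basis (Fin 3) ℚ ℚ⟮ρ⟯ := (adjoin.powerBasis hi).basis.reindex (finCongr hdim)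
  have hb : ∀ i, b i = (AdjoinSimple.gen ℚ ρ) ^ (i : ℕ) := by
    intro i
    simp [b]
  let M : Matrix (Fin 3) (Fin 3) ℚ :=
    !![(x : ℚ), z, y + a * z;
       y, x + (a + 3) * z, (a + 3) * y + (1 + a * (a + 3)) * z;
       z, y + a * z, x + a * y + (a ^ 2 + a + 3) * z]
  have hM : Algebra.leftMulMatrix b (el (AdjoinSimple.gen ℚ ρ) x y z) = M := by
    ext i j
    rw [Algebra.leftMulMatrix_eq_repr_mul]
    have : el (AdjoinSimple.gen ℚ ρ) x y z * b j = ∑ k, M k j • b k := by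
      rw [Fin.sum_univ_three, hb, hb, hb, hb]
      generalize AdjoinSimple.gen ℚ ρ = g at hg
      fin_cases j
      · simp [M, el, Algebra.smul_def]
      · simp [M, el, Algebra.smul_def]
        linear_combination (z : ℚ⟮ρ⟯) * hg
      · simp [M, el, Algebra.smul_def]
        linear_combination ((y : ℚ⟮ρ⟯) + z * (g + a)) * hg
    rw [this, Module.Basis.repr_sum_self]
  rw [Algebra.norm_eq_matrix_det b, hM, Matrix.det_fin_three]
  simp [M, nf]
  ring

/-- Let `a ≥ −1`, `ρ` the largest real root of `x³ − ax² − (a+3)x − 1`, and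
`K = ℚ(ρ)` the corresponding simplest cubic field; assume `O_K = ℤ[ρ]`. Write `a = 3A + a₀`
with `A ≥ 0` and `a₀ ∈ {0,1,2}`. If `α` is indecomposable in `O_K`, then
`N(α) ≤ a² + 3a + 9` if `a ≤ 3`, and for `a ≥ 4`:
`N(α) ≤ 3A⁴ + 14A³ + 28A² + 27A + 11` if `a₀ = 2`,
`N(α) ≤ 3A⁴ + 10A³ + 16A² + 13A + 5` if `a₀ = 1`, and
`N(α) ≤ 3A⁴ + 6A³ + 9A² + 6A + 3` if `a₀ = 0`. -/
theorem stmt_1 (a A a₀ : ℤ) (ha : -1 ≤ a) (hA : 0 ≤ A)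
    (ha₀ : a₀ = 0 ∨ a₀ = 1 ∨ a₀ = 2) (haA : a = 3 * A + a₀)
    (ρ : ℝ) (hroot : ρ ^ 3 - (a : ℝ) * ρ ^ 2 - ((a : ℝ) + 3) * ρ - 1 = 0)
    (hmax : ∀ x : ℝ, x ^ 3 - (a : ℝ) * x ^ 2 - ((a : ℝ) + 3) * x - 1 = 0 → x ≤ ρ)
    (hdeg : Module.finrank ℚ ℚ⟮ρ⟯ = 3)
    (hOK : Algebra.adjoin ℤ {AdjoinSimple.gen ℚ ρ} = integralClosure ℤ ℚ⟮ρ⟯)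
    (α : ℚ⟮ρ⟯)
    (hα : IsIndecomposableIn (integralClosure ℤ ℚ⟮ρ⟯) α) :
    (a ≤ 3 → Algebra.norm ℚ α ≤ ((a ^ 2 + 3 * a + 9 : ℤ) : ℚ)) ∧
    (4 ≤ a → a₀ = 2 →
      Algebra.norm ℚ α ≤ ((3 * A ^ 4 + 14 * A ^ 3 + 28 * A ^ 2 + 27 * A + 11 : ℤ) : ℚ)) ∧
    (4 ≤ a → a₀ = 1 →
      Algebra.norm ℚ α ≤ ((3 * A ^ 4 + 10 * A ^ 3 + 16 * A ^ 2 + 13 * A + 5 : ℤ) : ℚ)) ∧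
    (4 ≤ a → a₀ = 0 →
      Algebra.norm ℚ α ≤ ((3 * A ^ 4 + 6 * A ^ 3 + 9 * A ^ 2 + 6 * A + 3 : ℤ) : ℚ)) := by
  have ha' : 0 ≤ a := by omega
  set g : ℚ⟮ρ⟯ := AdjoinSimple.gen ℚ ρ with hgdef
  have hg := gen_root a ρ hroot
  obtain ⟨n, hn, hcase⟩ := core a g (integralClosure ℤ ℚ⟮ρ⟯) ha' hg
    (mem_iff_el a g hg _ hOK.symm) (norm_el a ρ hroot hdeg) (fun x y z h =>
      functionals_nonneg a ρ hroot hdeg x y z h)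
    (fun h => by
      have := h (algebraMap ℚ⟮ρ⟯ ℝ)
      simp at this) α hα
  rw [hn]
  have hb : n = 1 ∨ n = a ^ 2 + 3 * a + 9 ∨
      ((a = 3 * A → n ≤ 3 * A ^ 4 + 6 * A ^ 3 + 9 * A ^ 2 + 6 * A + 3) ∧
      (a = 3 * A + 1 → n ≤ 3 * A ^ 4 + 10 * A ^ 3 + 16 * A ^ 2 + 13 * A + 5) ∧
      (a = 3 * A + 2 → n ≤ 3 * A ^ 4 + 14 * A ^ 3 + 28 * A ^ 2 + 27 * A + 11)) := by
    rcases hcase with h | h | ⟨v, s, t, hv, hs, ht, hsum, h⟩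
    · exact Or.inl h
    · exact Or.inr (Or.inl h)
    · right; right
      rw [h, ← hsum]
      exact tri_bound A v s t hv hs ht
  clear hcase hn hα hOK hdeg hmax hroot hg
  refine ⟨fun h => ?_, fun h h2 => ?_, fun h h2 => ?_, fun h h2 => ?_⟩
  · apply Int.cast_le.2
    have : (A = 0 ∧ a = 0) ∨ (A = 0 ∧ a = 1) ∨ (A = 0 ∧ a = 2) ∨ (A = 1 ∧ a = 3) := by omega
    rcases this with ⟨h1, h2⟩ | ⟨h1, h2⟩ | ⟨h1, h2⟩ | ⟨h1, h2⟩ <;> rw [h1, h2] at hb <;>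
      rw [h2] <;> norm_num at hb ⊢ <;> omega
  · apply Int.cast_le.2
    obtain ⟨B, rfl⟩ : ∃ B, A = B + 1 := ⟨A - 1, by ring⟩
    have hB : 0 ≤ B := by omega
    have p2 : 0 ≤ B ^ 2 := by positivity
    have p3 : 0 ≤ B ^ 3 := by positivity
    have p4 : 0 ≤ B ^ 4 := by positivity
    subst h2
    rcases hb with hb | hb | hb
    · rw [hb]; nlinarith
    · rw [hb, haA]; nlinarith
    · exact hb.2.2 haA
  · apply Int.cast_le.2
    obtain ⟨B, rfl⟩ : ∃ B, A = B + 1 := ⟨A - 1, by ring⟩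
    have hB : 0 ≤ B := by omega
    have p2 : 0 ≤ B ^ 2 := by positivity
    have p3 : 0 ≤ B ^ 3 := by positivity
    have p4 : 0 ≤ B ^ 4 := by positivity
    subst h2
    rcases hb with hb | hb | hb
    · rw [hb]; nlinarith
    · rw [hb, haA]; nlinarith
    · exact hb.2.1 haA
  · apply Int.cast_le.2
    obtain ⟨B, rfl⟩ : ∃ B, A = B + 2 := ⟨A - 2, by ring⟩
    have hB : 0 ≤ B := by omega
    have p2 : 0 ≤ B ^ 2 := by positivity
    have p3 : 0 ≤ B ^ 3 := by positivity
    have p4 : 0 ≤ B ^ 4 := by positivity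
    subst h2
    rcases hb with hb | hb | hb
    · rw [hb]; nlinarith
    · rw [hb, haA]; nlinarith
    · exact hb.1 (by omega)
end
end

section
/- Let a ≥ 3 be a rational integer, ρ the root of x³ + (a−1)x² − ax − 1 lying in the interval (1 + 1/(a+3), 1 + 1/(a+2)), and K = ℚ(ρ) the corresponding Ennola cubic field. If α is indecomposable in ℤ[ρ] and α is not a unit of ℤ[ρ], then the minimum of Tr_{K/ℚ}(αδ) over all δ ∈ ℤ[ρ]^{∨,+} equals 2. -/
open IntermediateField

noncomputable section

section core

variable {K : Type*} [Field K]

/-- The element with integer coordinates `p, q, r` in the power basis. -/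
def EE (g : K) (p q r : ℤ) : K := (p : K) + (q : K) * g + (r : K) * g ^ 2

lemma EE_mem (g : K) (p q r : ℤ) : EE g p q r ∈ Algebra.adjoin ℤ {g} := by
  have hg : g ∈ Algebra.adjoin ℤ {g} := Algebra.self_mem_adjoin_singleton ℤ g
  unfold EE
  refine add_mem (add_mem (intCast_mem _ p) (mul_mem (intCast_mem _ q) hg))
    (mul_mem (intCast_mem _ r) (pow_mem hg 2))

lemma EE_of_mem (a : ℤ) (g : K) (hg : g ^ 3 = 1 + a * g - (a - 1) * g ^ 2) (x : K)
    (hx : x ∈ Algebra.adjoin ℤ {g}) : ∃ p q r : ℤ, x = EE g p q r := by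
  induction hx using Algebra.adjoin_induction with
  | mem x hx => 
    rw [Set.mem_singleton_iff] at hx
    exact ⟨0, 1, 0, by simp [EE, hx]⟩
  | algebraMap n => exact ⟨n, 0, 0, by simp [EE]⟩
  | add x y _ _ h1 h2 =>
    obtain ⟨p, q, r, rfl⟩ := h1
    obtain ⟨p', q', r', rfl⟩ := h2
    exact ⟨p + p', q + q', r + r', by simp only [EE]; push_cast; ring⟩
  | mul x y _ _ h1 h2 =>
    obtain ⟨p, q, r, rfl⟩ := h1
    obtain ⟨P, Q, R, rfl⟩ := h2
    have hg4 : g ^ 4 = g + a * g ^ 2 - (a - 1) * (1 + a * g - (a - 1) * g ^ 2) := by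
      rw [← hg]; linear_combination g * hg
    refine ⟨p * P + (q * R + r * Q) - (a - 1) * (r * R),
      p * Q + q * P + a * (q * R + r * Q) + r * R * (1 - (a - 1) * a),
      p * R + q * Q + r * P - (a - 1) * (q * R + r * Q) + r * R * (a + (a - 1) ^ 2), ?_⟩
    simp only [EE]; push_cast
    linear_combination ((q : K) * R + r * Q) * hg + (r : K) * R * hg4

lemma tp_mul {x y : K} (hx : TotallyPositive x) (hy : TotallyPositive y) :
    TotallyPositive (x * y) := fun φ => by
  rw [map_mul]; exact mul_pos (hx φ) (hy φ)

lemma tp_add {x y : K} (hx : TotallyPositive x) (hy : TotallyPositive y) :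
    TotallyPositive (x + y) := fun φ => by
  rw [map_add]; exact add_pos (hx φ) (hy φ)

lemma tp_inv {x y : K} (hx : TotallyPositive x) (h : x * y = 1) :
    TotallyPositive y := fun φ => by
  have h1 : φ x * φ y = 1 := by rw [← map_mul, h, map_one]
  have := hx φ
  by_contra h2
  push Not at h2
  nlinarith

lemma indec_mul {O : Subalgebra ℤ K} {α u v : K} (hu : u ∈ O) (hv : v ∈ O) (huv : u * v = 1)
    (htp : TotallyPositive u) (h : IsIndecomposableIn O α) : IsIndecomposableIn O (α * u) := by
  obtain ⟨h1, h2, h3⟩ := h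
  refine ⟨mul_mem h1 hu, tp_mul h2 htp, ?_⟩
  rintro ⟨β, γ, hβ, hγ, tβ, tγ, e⟩
  have tv := tp_inv htp huv
  refine h3 ⟨β * v, γ * v, mul_mem hβ hv, mul_mem hγ hv, tp_mul tβ tv, tp_mul tγ tv, ?_⟩
  linear_combination v * e - α * huv

/-- Up to a totally positive unit, `α` is either a unit or `1 + k g + g ^ 2`. -/
def Concl (a : ℤ) (g α : K) : Prop :=
  ∃ u v : K, u ∈ Algebra.adjoin ℤ {g} ∧ v ∈ Algebra.adjoin ℤ {g} ∧ u * v = 1 ∧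
    TotallyPositive u ∧ (α * u = 1 ∨ ∃ k : ℤ, 1 ≤ k ∧ k < a ∧ α * u = EE g 1 k 1)

lemma concl_mul {a : ℤ} {g α u v : K} (hu : u ∈ Algebra.adjoin ℤ {g})
    (hv : v ∈ Algebra.adjoin ℤ {g}) (huv : u * v = 1)
    (htp : TotallyPositive u) (h : Concl a g (α * u)) : Concl a g α := by
  obtain ⟨U, V, hU, hV, hUV, tU, h⟩ := h
  refine ⟨u * U, v * V, mul_mem hu hU, mul_mem hv hV, ?_, tp_mul htp tU, ?_⟩
  · linear_combination huv * U * V + hUV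
  · rwa [← mul_assoc]

/-- A nonnegative combination of three totally positive elements which is indecomposable is
one of them. -/
lemma comb_eq {O : Subalgebra ℤ K} {α x y z : K} (hx : x ∈ O) (hy : y ∈ O) (hz : z ∈ O)
    (tx : TotallyPositive x) (ty : TotallyPositive y) (tz : TotallyPositive z)
    (φ : K →+* ℝ)
    (l m n : ℕ) (e : α = l * x + m * y + n * z) (h : IsIndecomposableIn O α) :
    α = x ∨ α = y ∨ α = z := by
  obtain ⟨h1, h2, h3⟩ := h
  have key : ∀ b c : K, b ∈ O → c ∈ O → TotallyPositive b → (c = 0 ∨ TotallyPositive c) →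
      α = b + c → α = b := by
    intro b c hb hc tb tc e
    rcases tc with rfl | tc
    · simpa using e
    · exact absurd ⟨b, c, hb, hc, tb, tc, e⟩ h3
  have tn : ∀ (k : ℕ) (b : K), TotallyPositive b → ((k : K) * b = 0 ∨ TotallyPositive ((k : K) * b)) := by
    intro k b tb
    rcases Nat.eq_zero_or_pos k with rfl | hk
    · left; simp
    · right
      intro ψ
      rw [map_mul, map_natCast]
      exact mul_pos (by exact_mod_cast hk) (tb ψ)
  have ta : ∀ b c : K, (b = 0 ∨ TotallyPositive b) → (c = 0 ∨ TotallyPositive c) →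
      (b + c = 0 ∨ TotallyPositive (b + c)) := by
    rintro b c (rfl | hb) (rfl | hc)
    · left; simp
    · right; simpa using hc
    · right; simpa using hb
    · right; exact tp_add hb hc
  have mm : ∀ (k : ℕ) (b : K), b ∈ O → (k : K) * b ∈ O := fun k b hb =>
    mul_mem (natCast_mem _ k) hb
  rcases l with _ | l
  · rcases m with _ | m
    · rcases n with _ | n
      · exfalso
        have := h2 φ
        simp [e] at this
      · right; right
        exact key z (n * z) hz (mm _ _ hz) tz (tn _ _ tz) (by rw [e]; push_cast; ring)
    · right; left
      exact key y (m * y + n * z) hy (add_mem (mm _ _ hy) (mm _ _ hz)) ty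
        (ta _ _ (tn _ _ ty) (tn _ _ tz)) (by rw [e]; push_cast; ring)
  · left
    exact key x (l * x + (m * y + n * z)) hx (add_mem (mm _ _ hx) (add_mem (mm _ _ hy) (mm _ _ hz))) tx
        (ta _ _ (tn _ _ tx) (ta _ _ (tn _ _ ty) (tn _ _ tz))) (by rw [e]; push_cast; ring)

lemma cone1 (g : K) (φ : K →+* ℝ)
    (tg : TotallyPositive (EE g 0 0 1)) (tw : TotallyPositive (EE g 0 (-1) 1))
    (p q r : ℤ) (hp : 0 ≤ p) (hq : q ≤ 0) (hr : 0 ≤ q + r)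
    (h : IsIndecomposableIn (Algebra.adjoin ℤ {g}) (EE g p q r)) :
    EE g p q r = EE g 1 0 0 ∨ EE g p q r = EE g 0 0 1 ∨ EE g p q r = EE g 0 (-1) 1 := by
  obtain ⟨l, rfl⟩ := Int.eq_ofNat_of_zero_le hp
  obtain ⟨m, hm⟩ := Int.eq_ofNat_of_zero_le hr
  obtain ⟨n, hn⟩ := Int.eq_ofNat_of_zero_le (show 0 ≤ -q by omega)
  obtain rfl : q = -n := by omega
  obtain rfl : r = m + n := by omega
  refine comb_eq (EE_mem g 1 0 0) (EE_mem g 0 0 1) (EE_mem g 0 (-1) 1) ?_ tg tw φ l m n ?_ h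
  · intro φ; simp [EE]
  · simp only [EE]; push_cast; ring

lemma cone2 (a : ℤ) (ha : 3 ≤ a) (g : K) (φ : K →+* ℝ)
    (tg : TotallyPositive (EE g 0 0 1)) (tv : TotallyPositive (EE g 1 a 1))
    (t1 : ∀ k : ℤ, 0 ≤ k → k ≤ a → TotallyPositive (EE g 1 k 1))
    (p q r : ℤ) (hq : 0 ≤ q) (hp : q ≤ a * p) (hr : q ≤ a * r)
    (h : IsIndecomposableIn (Algebra.adjoin ℤ {g}) (EE g p q r)) :
    EE g p q r = EE g 1 0 0 ∨ EE g p q r = EE g 0 0 1 ∨ 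
      ∃ k : ℤ, 1 ≤ k ∧ k ≤ a ∧ EE g p q r = EE g 1 k 1 := by
  have tone : TotallyPositive (EE g 1 0 0) := by intro φ; simp [EE]
  -- write `q = a * m + k`
  set m := q / a
  set k := q % a with hk
  have hqk : q = a * m + k := (Int.mul_ediv_add_emod q a).symm
  have hk0 : 0 ≤ k := Int.emod_nonneg _ (by omega)
  have hka : k < a := Int.emod_lt_of_pos _ (by omega)
  have hm0 : 0 ≤ m := Int.ediv_nonneg hq (by omega)
  have hpm : m ≤ p := by
    by_contra hc
    have : p + 1 ≤ m := by omega
    nlinarith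
  have hrm : m ≤ r := by
    by_contra hc
    have : r + 1 ≤ m := by omega
    nlinarith
  rcases hk0.eq_or_lt with hk0 | hk0
  · obtain ⟨n, hn⟩ := Int.eq_ofNat_of_zero_le hm0
    obtain ⟨l, hl⟩ := Int.eq_ofNat_of_zero_le (show 0 ≤ p - m by omega)
    obtain ⟨s, hs⟩ := Int.eq_ofNat_of_zero_le (show 0 ≤ r - m by omega)
    have := comb_eq (EE_mem g 1 0 0) (EE_mem g 0 0 1) (EE_mem g 1 a 1) tone tg tv φ l s n ?_ h
    · rcases this with h | h | h
      · left; exact h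
      · right; left; exact h
      · right; right; exact ⟨a, by omega, le_rfl, h⟩
    · obtain rfl : p = l + n := by omega
      obtain rfl : r = s + n := by omega
      have : q = a * n := by rw [hqk, ← hk0, hn]; ring
      rw [this]
      simp only [EE]; push_cast; ring
  · have hpm : m < p := by
      by_contra hc
      have : p = m := by omega
      subst this
      omega
    have hrm : m < r := by
      by_contra hc
      have : r = m := by omega
      subst this
      omega
    obtain ⟨n, hn⟩ := Int.eq_ofNat_of_zero_le hm0
    obtain ⟨l, hl⟩ := Int.eq_ofNat_of_zero_le (show 0 ≤ p - m - 1 by omega)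
    obtain ⟨s, hs⟩ := Int.eq_ofNat_of_zero_le (show 0 ≤ r - m - 1 by omega)
    right; right
    -- `α = α_k + l + s g ^ 2 + n v`
    obtain ⟨h1, h2, h3⟩ := h
    by_cases hz : l = 0 ∧ s = 0 ∧ n = 0
    · obtain ⟨rfl, rfl, rfl⟩ := hz
      refine ⟨k, by omega, hka.le, ?_⟩
      have e1 : p = 1 := by omega
      have e2 : r = 1 := by omega
      have e3 : q = k := by rw [hqk, hn]; simp
      rw [e1, e2, ← e3]
    · exfalso
      refine h3 ⟨EE g 1 k 1, EE g (l + n) (a * n) (s + n), EE_mem _ _ _ _, EE_mem _ _ _ _,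
        t1 k hk0.le hka.le, ?_, ?_⟩
      · intro ψ
        have e : ψ (EE g (l + n) (a * n) (s + n)) = l * ψ (EE g 1 0 0) + s * ψ (EE g 0 0 1)
            + n * ψ (EE g 1 a 1) := by
          simp [EE]; ring
        rw [e]
        have b1 := tone ψ
        have b2 := tg ψ
        have b3 := tv ψ
        rcases Nat.eq_zero_or_pos l with hl | hl
        · rcases Nat.eq_zero_or_pos s with hs | hs
          · rcases Nat.eq_zero_or_pos n with hn | hn
            · exact absurd ⟨hl, hs, hn⟩ hz
            · have : (0 : ℝ) < n := by exact_mod_cast hn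
              positivity
          · have : (0 : ℝ) < s := by exact_mod_cast hs
            positivity
        · have : (0 : ℝ) < l := by exact_mod_cast hl
          positivity
      · obtain rfl : p = l + n + 1 := by omega
        obtain rfl : r = s + n + 1 := by omega
        rw [hqk, hn]
        simp only [EE]; push_cast; ring

lemma reduction (a : ℤ) (ha : 3 ≤ a) (g : K) (hg : g ^ 3 = 1 + a * g - (a - 1) * g ^ 2)
    (φ : K →+* ℝ)
    (tg : TotallyPositive (EE g 0 0 1)) (tw : TotallyPositive (EE g 0 (-1) 1))
    (tv : TotallyPositive (EE g 1 a 1))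
    (t1 : ∀ k : ℤ, 0 ≤ k → k ≤ a → TotallyPositive (EE g 1 k 1))
    (hL1 : ∀ p q r : ℤ, TotallyPositive (EE g p q r) → 0 < p + r)
    (hL2 : ∀ p q r : ℤ, TotallyPositive (EE g p q r) → 0 < a * (p + r) - q) (n : ℕ) :
    ∀ p q r : ℤ, IsIndecomposableIn (Algebra.adjoin ℤ {g}) (EE g p q r) →
      (a * (p + r) ≤ n ∨ a * (p + r) - q ≤ n) → Concl a g (EE g p q r) := by
  have hg4 : g ^ 4 = g + a * g ^ 2 - (a - 1) * (1 + a * g - (a - 1) * g ^ 2) := by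
    rw [← hg]; linear_combination g * hg
  -- the units
  have vv : EE g 1 a 1 * EE g (1 + a) (-(a - 1)) (-1) = 1 := by
    simp only [EE]; push_cast
    linear_combination -hg4 - (a + (a - 1)) * hg
  have ww : EE g 0 (-1) 1 * EE g a 1 0 = 1 := by
    simp only [EE]; push_cast
    linear_combination hg
  have g1 : g * EE g (-a) (a - 1) 1 = 1 := by
    simp only [EE]; push_cast
    linear_combination hg
  have gg : EE g 0 0 1 * (EE g (-a) (a - 1) 1) ^ 2 = 1 := by
    have : EE g 0 0 1 = g ^ 2 := by simp [EE]
    rw [this, ← mul_pow, g1, one_pow]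
  have vv' := (mul_comm _ _).trans vv
  have ww' := (mul_comm _ _).trans ww
  have tv' := tp_inv tv vv
  have tw' := tp_inv tw ww
  have fin1 : Concl a g (EE g 1 0 0) :=
    ⟨1, 1, one_mem _, one_mem _, by simp, fun φ => by simp, Or.inl (by simp [EE])⟩
  have finu : ∀ x y : K, x ∈ Algebra.adjoin ℤ {g} → y ∈ Algebra.adjoin ℤ {g} → x * y = 1 →
      TotallyPositive x → Concl a g x := fun x y hx hy h t =>
    ⟨y, x, hy, hx, by rw [mul_comm]; exact h, tp_inv t h, Or.inl h⟩
  have fing := finu _ _ (EE_mem _ _ _ _) (pow_mem (EE_mem _ _ _ _) 2) gg tg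
  have finv := finu _ _ (EE_mem _ _ _ _) (EE_mem _ _ _ _) vv tv
  have finw := finu _ _ (EE_mem _ _ _ _) (EE_mem _ _ _ _) ww tw
  have finc1 : ∀ p q r : ℤ, IsIndecomposableIn (Algebra.adjoin ℤ {g}) (EE g p q r) →
      0 ≤ p → q ≤ 0 → 0 ≤ q + r → Concl a g (EE g p q r) := by
    intro p q r h h1 h2 h3
    rcases cone1 g φ tg tw p q r h1 h2 h3 h with e | e | e <;> rw [e] <;> assumption
  have finc2 : ∀ p q r : ℤ, IsIndecomposableIn (Algebra.adjoin ℤ {g}) (EE g p q r) →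
      0 ≤ q → q ≤ a * p → q ≤ a * r → Concl a g (EE g p q r) := by
    intro p q r h h1 h2 h3
    rcases cone2 a ha g φ tg tv t1 p q r h1 h2 h3 h with e | e | ⟨k, k1, k2, e⟩
    · rw [e]; assumption
    · rw [e]; assumption
    · rcases k2.eq_or_lt with rfl | k2
      · rw [e]; exact finv
      · exact ⟨1, 1, one_mem _, one_mem _, by simp, fun φ => by simp,
          Or.inr ⟨k, k1, k2, by rw [e, mul_one]⟩⟩
  -- multiplication by units
  have mv : ∀ p q r : ℤ, EE g p q r * EE g 1 a 1
      = EE g (p + q + r) (a * (p + q + r) + q + r) (p + q + 2 * r) := by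
    intro p q r
    simp only [EE]; push_cast
    linear_combination (r : K) * hg4 + ((q : K) + r * a) * hg
  have mw' : ∀ p q r : ℤ, EE g p q r * EE g a 1 0
      = EE g (r + a * p) (p + a * r + a * q) (q + r) := by
    intro p q r
    simp only [EE]; push_cast
    linear_combination (r : K) * hg
  have mv' : ∀ p q r : ℤ, EE g p q r * EE g (1 + a) (-(a - 1)) (-1)
      = EE g ((1 + a) * p - q) (-(a - 1) * p + q - r) (r - p) := by
    intro p q r
    simp only [EE]; push_cast
    linear_combination -(r : K) * hg4 - (q + r * (a - 1)) * hg
  have mw : ∀ p q r : ℤ, EE g p q r * EE g 0 (-1) 1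
      = EE g (q - a * r) (r - p + a * (q - a * r)) (p + a ^ 2 * r - a * q) := by
    intro p q r
    simp only [EE]; push_cast
    linear_combination (r : K) * hg4 + (q - r) * hg
  induction n with
  | zero =>
    intro p q r h hn
    exfalso
    have h1 := hL1 p q r h.2.1
    have h2 := hL2 p q r h.2.1
    rcases hn with hn | hn
    · push_cast at hn; nlinarith
    · push_cast at hn; omega
  | succ n ih =>
    intro p q r h hn
    push_cast at hn
    rcases hn with hn | hn
    · by_cases c1 : q ≤ 0
      · by_cases c2 : 0 ≤ q + r
        · by_cases c3 : 0 ≤ p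
          · exact finc1 p q r h c3 c1 c2
          · have h' := indec_mul (EE_mem _ _ _ _) (EE_mem _ _ _ _) ww' tw' h
            refine concl_mul (EE_mem _ _ _ _) (EE_mem _ _ _ _) ww' tw' ?_
            rw [mw'] at h' ⊢
            refine ih _ _ _ h' (Or.inr ?_)
            have : 0 < (a ^ 2 - a - 1) * (-p) := mul_pos (by nlinarith) (by omega)
            have e : a * (r + a * p + (q + r)) - (p + a * r + a * q) = a * (p + r) - (a ^ 2 - a - 1) * (-p) := by ring
            omega
        · have h' := indec_mul (EE_mem _ _ _ _) (EE_mem _ _ _ _) vv tv h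
          refine concl_mul (EE_mem _ _ _ _) (EE_mem _ _ _ _) vv tv ?_
          rw [mv] at h' ⊢
          refine ih _ _ _ h' (Or.inr ?_)
          have : 0 < (a - 1) * (-(q + r)) := mul_pos (by omega) (by omega)
          have e : a * (p + q + r + (p + q + 2 * r)) - (a * (p + q + r) + q + r)
            = a * (p + r) - (a - 1) * (-(q + r)) := by ring
          omega
      · exact ih p q r h (Or.inr (by omega))
    · by_cases c1 : 0 ≤ q
      · by_cases c2 : q ≤ a * p
        · by_cases c3 : q ≤ a * r
          · exact finc2 p q r h c1 c2 c3
          · have h' := indec_mul (EE_mem _ _ _ _) (EE_mem _ _ _ _) ww tw h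
            refine concl_mul (EE_mem _ _ _ _) (EE_mem _ _ _ _) ww tw ?_
            rw [mw] at h' ⊢
            refine ih _ _ _ h' (Or.inl ?_)
            have : 0 < (a ^ 2 - a - 1) * (q - a * r) := mul_pos (by nlinarith) (by omega)
            have e : a * (q - a * r + (p + a ^ 2 * r - a * q)) = a * (p + r) - q - (a ^ 2 - a - 1) * (q - a * r) := by ring
            omega
        · have h' := indec_mul (EE_mem _ _ _ _) (EE_mem _ _ _ _) vv' tv' h
          refine concl_mul (EE_mem _ _ _ _) (EE_mem _ _ _ _) vv' tv' ?_
          rw [mv'] at h' ⊢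
          refine ih _ _ _ h' (Or.inl ?_)
          have : 0 < (a - 1) * (q - a * p) := mul_pos (by omega) (by omega)
          have e : a * ((1 + a) * p - q + (r - p)) = a * (p + r) - q - (a - 1) * (q - a * p) := by ring
          omega
      · exact ih p q r h (Or.inl (by omega))


lemma lagrange (x y z c0 c1 p q r : ℝ) (h1 : y < x) (h2 : z < y) :
    (p + q * x + r * x ^ 2) * ((c0 * (y * z + 1) - c1 * (y + z)) / ((x - y) * (x - z)))
    + (p + q * y + r * y ^ 2) * ((c0 * (x * z + 1) - c1 * (x + z)) / ((y - x) * (y - z)))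
    + (p + q * z + r * z ^ 2) * ((c0 * (x * y + 1) - c1 * (x + y)) / ((z - x) * (z - y)))
    = c0 * (p + r) + c1 * q := by
  have a1 : x - y ≠ 0 := by linarith
  have a2 : x - z ≠ 0 := by linarith
  have a3 : y - z ≠ 0 := by linarith
  have a4 : y - x ≠ 0 := by linarith
  have a5 : z - x ≠ 0 := by linarith
  have a6 : z - y ≠ 0 := by linarith
  have e1 : y - x = -(x - y) := by ring
  have e2 : z - x = -(x - z) := by ring
  have e3 : z - y = -(y - z) := by ring
  rw [e1, e2, e3]
  field_simp
  ring

lemma core_thm [Algebra ℚ K] (a : ℤ) (ha : 3 ≤ a) (g : K)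
    (hg : g ^ 3 = 1 + a * g - (a - 1) * g ^ 2) (φ₁ φ₂ φ₃ : K →+* ℝ) (x y z : ℝ)
    (hx : φ₁ g = x) (hy : φ₂ g = y) (hz : φ₃ g = z)
    (hx1 : 1 < x) (hx2 : x < 2) (hy1 : -1 < y) (hy2 : y < 0) (hz1 : -(a : ℝ) < z)
    (hz2 : z < -(a : ℝ) + 1)
    (hs1 : x + y + z = -((a : ℝ) - 1)) (hs2 : x * y + y * z + x * z = -(a : ℝ))
    (hs3 : x * y * z = 1)
    (hcov : ∀ ψ : K →+* ℝ, ψ = φ₁ ∨ ψ = φ₂ ∨ ψ = φ₃)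
    (htr : ∀ u : K, ((Algebra.trace ℚ K u : ℚ) : ℝ) = φ₁ u + φ₂ u + φ₃ u)
    (α : K)
    (hind : IsIndecomposableIn (Algebra.adjoin ℤ {g}) α)
    (hnotunit : ¬ ∃ β ∈ Algebra.adjoin ℤ {g}, α * β = 1) :
    IsLeast {q : ℚ | ∃ δ ∈ CodifferentPlus (Algebra.adjoin ℤ {g}),
      Algebra.trace ℚ K (α * δ) = q} 2 := by
  have haR : (3 : ℝ) ≤ a := by exact_mod_cast ha
  have tpi : ∀ u : K, 0 < φ₁ u → 0 < φ₂ u → 0 < φ₃ u → TotallyPositive u := by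
    intro u h1 h2 h3 ψ
    rcases hcov ψ with rfl | rfl | rfl <;> assumption
  have ev : ∀ (ψ : K →+* ℝ) (p q r : ℤ), ψ (EE g p q r) = p + q * ψ g + r * ψ g ^ 2 := by
    intro ψ p q r; simp [EE]
  have hroot : ∀ ψ : K →+* ℝ, ψ g ^ 3 = 1 + a * ψ g - (a - 1) * ψ g ^ 2 := by
    intro ψ
    have := congrArg ψ hg
    simpa using this
  have hsgn : ∀ ψ : K →+* ℝ, 1 < ψ g ∨ ψ g < 0 := by
    intro ψ
    rcases hcov ψ with rfl | rfl | rfl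
    · left; rw [hx]; exact hx1
    · right; rw [hy]; exact hy2
    · right; rw [hz]; linarith
  have tg : TotallyPositive (EE g 0 0 1) := by
    intro ψ
    rw [ev]
    rcases hsgn ψ with h | h
    · push_cast; nlinarith
    · push_cast; nlinarith
  have tw : TotallyPositive (EE g 0 (-1) 1) := by
    intro ψ
    rw [ev]
    rcases hsgn ψ with h | h
    · push_cast; nlinarith
    · push_cast; nlinarith
  have t1 : ∀ k : ℤ, 0 ≤ k → k ≤ a → TotallyPositive (EE g 1 k 1) := by
    intro k hk0 hka ψ
    rw [ev]
    have hk0' : (0 : ℝ) ≤ k := by exact_mod_cast hk0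
    have hka' : (k : ℝ) ≤ a := by exact_mod_cast hka
    rcases hsgn ψ with h | h
    · push_cast; positivity
    · push_cast
      have e : (1 - ψ g) * (1 + a * ψ g + ψ g ^ 2) = - ψ g := by
        linear_combination -hroot ψ
      have : 0 < 1 + a * ψ g + ψ g ^ 2 := by
        by_contra hc
        push Not at hc
        nlinarith
      nlinarith
  have tv := t1 a (by omega) le_rfl
  -- positivity of the weights
  have pyz : 0 < y * z := mul_pos_of_neg_of_neg hy2 (by linarith)
  have d1 : 0 < (x - y) * (x - z) := mul_pos (by linarith) (by linarith)
  have d2 : (y - x) * (y - z) < 0 := mul_neg_of_neg_of_pos (by linarith) (by linarith)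
  have d3 : 0 < (z - x) * (z - y) := mul_pos_of_neg_of_neg (by linarith) (by linarith)
  have n1 : 0 < y * z + 1 := by linarith
  have n2 : x * z + 1 < 0 := by nlinarith
  have n3 : 0 < x * y + 1 := by
    by_contra hc
    nlinarith
  have w1 : 0 < (y * z + 1) / ((x - y) * (x - z)) := div_pos n1 d1
  have w2 : 0 < (x * z + 1) / ((y - x) * (y - z)) := div_pos_of_neg_of_neg n2 d2
  have w3 : 0 < (x * y + 1) / ((z - x) * (z - y)) := div_pos n3 d3
  have hL : ∀ p q r : ℤ, ∀ c0 c1 : ℤ, 0 < (c0 * (y * z + 1) - c1 * (y + z)) → 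
      (c0 * (x * z + 1) - c1 * (x + z)) < 0 → 0 < (c0 * (x * y + 1) - c1 * (x + y)) → 
      TotallyPositive (EE g p q r) → 0 < c0 * (p + r) + c1 * q := by
    intro p q r c0 c1 m1 m2 m3 h
    have h1 := h φ₁
    have h2 := h φ₂
    have h3 := h φ₃
    rw [ev] at h1 h2 h3
    rw [hx] at h1
    rw [hy] at h2
    rw [hz] at h3
    have := lagrange x y z c0 c1 p q r (by linarith) (by linarith)
    have k1 := mul_pos h1 (div_pos m1 d1)
    have k2 := mul_pos h2 (div_pos_of_neg_of_neg m2 d2)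
    have k3 := mul_pos h3 (div_pos m3 d3)
    have : (0 : ℝ) < c0 * (p + r) + c1 * q := by linarith
    exact_mod_cast this
  have hL1 : ∀ p q r : ℤ, TotallyPositive (EE g p q r) → 0 < p + r := by
    intro p q r h
    have := hL p q r 1 0 (by push_cast; linarith) (by push_cast; linarith)
      (by push_cast; linarith) h
    linarith
  have hL2 : ∀ p q r : ℤ, TotallyPositive (EE g p q r) → 0 < a * (p + r) - q := by
    intro p q r h
    have hyz : 1 / 2 < y * z := by nlinarith
    have := hL p q r a (-1) (by push_cast; nlinarith) (by push_cast; nlinarith)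
      (by push_cast; nlinarith) h
    linarith
  obtain ⟨p, q, r, hα⟩ := EE_of_mem a g hg α hind.1
  have hc : Concl a g α := by
    rw [hα] at hind ⊢
    refine reduction a ha g hg φ₁ tg tw tv t1 hL1 hL2 (a * (p + r)).toNat p q r hind (Or.inl ?_)
    exact Int.self_le_toNat _
  obtain ⟨u, v, hu, hv, huv, tu, hc⟩ := hc
  rcases hc with hc | ⟨k, hk1, hk2, hk⟩
  · exact absurd ⟨u, hu, hc⟩ hnotunit
  have trpos : ∀ u : K, TotallyPositive u → 0 < Algebra.trace ℚ K u := by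
    intro u h
    have : (0 : ℝ) < ((Algebra.trace ℚ K u : ℚ) : ℝ) := by
      rw [htr]; linarith [h φ₁, h φ₂, h φ₃]
    exact_mod_cast this
  constructor
  · -- existence
    set D : K := 3 * g ^ 2 + 2 * (a - 1) * g - a with hD
    set N : K := g ^ 2 + (a - 1) * g - (a - 1) with hN
    have eD : ∀ ψ : K →+* ℝ, ψ D = 3 * ψ g ^ 2 + 2 * (a - 1) * ψ g - a := by
      intro ψ; simp [hD, map_ofNat]
    have eN : ∀ ψ : K →+* ℝ, ψ N = ψ g ^ 2 + (a - 1) * ψ g - (a - 1) := by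
      intro ψ; simp [hN]
    have q1 : φ₁ (N / D) = (y * z + 1) / ((x - y) * (x - z)) := by
      rw [map_div₀, eD, eN, hx]
      congr 1
      · linear_combination (x + 0) * hs1 - hs2
      · linear_combination 2 * x * hs1 - hs2
    have q2 : φ₂ (N / D) = (x * z + 1) / ((y - x) * (y - z)) := by
      rw [map_div₀, eD, eN, hy]
      congr 1
      · linear_combination (y + 0) * hs1 - hs2
      · linear_combination 2 * y * hs1 - hs2
    have q3 : φ₃ (N / D) = (x * y + 1) / ((z - x) * (z - y)) := by
      rw [map_div₀, eD, eN, hz]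
      congr 1
      · linear_combination (z + 0) * hs1 - hs2
      · linear_combination 2 * z * hs1 - hs2
    have tδ : TotallyPositive (N / D) := tpi _ (by rw [q1]; exact w1) (by rw [q2]; exact w2)
      (by rw [q3]; exact w3)
    have trE : ∀ p q r : ℤ, Algebra.trace ℚ K (EE g p q r * (N / D)) = ((p + r : ℤ) : ℚ) := by
      intro p q r
      have : ((Algebra.trace ℚ K (EE g p q r * (N / D)) : ℚ) : ℝ) = ((p + r : ℤ) : ℝ) := by
        rw [htr, map_mul, map_mul, map_mul, q1, q2, q3, ev, ev, ev, hx, hy, hz]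
        have := lagrange x y z 1 0 p q r (by linarith) (by linarith)
        simp only [one_mul, zero_mul, sub_zero, add_zero] at this
        rw [this]; push_cast; ring
      exact_mod_cast this
    refine ⟨u * (N / D), ⟨tp_mul tu tδ, ?_⟩, ?_⟩
    · intro β hβ
      obtain ⟨p', q', r', e⟩ := EE_of_mem a g hg (β * u) (mul_mem hβ hu)
      exact ⟨p' + r', by rw [← mul_assoc, e, trE]⟩
    · rw [← mul_assoc, hk, trE]; norm_num
  · rintro t ⟨δ, ⟨tδ, hδ⟩, rfl⟩
    have tv' := tp_inv tu huv
    have tvd := tp_mul tv' tδ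
    have gm : g ∈ Algebra.adjoin ℤ {g} := Algebra.self_mem_adjoin_singleton ℤ g
    obtain ⟨t0, ht0⟩ := hδ v hv
    obtain ⟨t1', ht1⟩ := hδ (g * v) (mul_mem gm hv)
    obtain ⟨t2, ht2⟩ := hδ (g ^ 2 * v) (mul_mem (pow_mem gm 2) hv)
    have trE : ∀ p q r : ℤ, Algebra.trace ℚ K (EE g p q r * (v * δ))
        = ((p * t0 + q * t1' + r * t2 : ℤ) : ℚ) := by
      intro p q r
      have e : EE g p q r * (v * δ) = p • (v * δ) + q • (g * v * δ) + r • (g ^ 2 * v * δ) := by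
        simp only [EE, zsmul_eq_mul]; ring
      rw [e, map_add, map_add, map_zsmul, map_zsmul, map_zsmul, ht0, ht1, ht2]
      simp
    have pE : ∀ p q r : ℤ, TotallyPositive (EE g p q r) → 0 < p * t0 + q * t1' + r * t2 := by
      intro p q r h
      have := trpos _ (tp_mul h tvd)
      rw [trE] at this
      exact_mod_cast this
    have b1 := pE 1 0 0 (by intro ψ; simp [EE])
    have b2 := pE 0 0 1 tg
    have b3 := pE 1 a 1 tv
    have e : α * δ = EE g 1 k 1 * (v * δ) := by
      rw [← hk]; linear_combination -α * δ * huv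
    rw [e, trE]
    have : 2 ≤ 1 * t0 + k * t1' + 1 * t2 := by
      by_contra hcon
      have h1 : 1 * t0 + k * t1' + 1 * t2 ≤ 1 := by omega
      have h2 : 2 ≤ t0 + t2 := by omega
      have h3 : 1 ≤ t0 + a * t1' + t2 := by omega
      have h4 : a * (1 * t0 + k * t1' + 1 * t2) = k * (t0 + a * t1' + t2) + (a - k) * (t0 + t2) := by
        ring
      have h5 : k * 1 ≤ k * (t0 + a * t1' + t2) := mul_le_mul_of_nonneg_left h3 (by omega)
      have h6 : (a - k) * 2 ≤ (a - k) * (t0 + t2) := mul_le_mul_of_nonneg_left h2 (by omega)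
      have h7 : a * (1 * t0 + k * t1' + 1 * t2) ≤ a * 1 := mul_le_mul_of_nonneg_left h1 (by omega)
      omega
    exact_mod_cast this

end core

open Polynomial in
lemma minpoly_eq (a : ℤ) (ρ : ℝ)
    (hroot : ρ ^ 3 + ((a : ℝ) - 1) * ρ ^ 2 - (a : ℝ) * ρ - 1 = 0)
    (hint : IsIntegral ℚ ρ)
    (hdeg : Module.finrank ℚ ℚ⟮ρ⟯ = 3) :
    minpoly ℚ ρ = X ^ 3 + C ((a : ℚ) - 1) * X ^ 2 - C (a : ℚ) * X - 1 := by
  have hm : (X ^ 3 + C ((a : ℚ) - 1) * X ^ 2 - C (a : ℚ) * X - 1 : ℚ[X]).Monic := by monicity!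
  have hd : (X ^ 3 + C ((a : ℚ) - 1) * X ^ 2 - C (a : ℚ) * X - 1 : ℚ[X]).natDegree = 3 := by
    compute_degree!
  have h3 : (minpoly ℚ ρ).natDegree = 3 := by
    rw [← IntermediateField.adjoin.finrank hint, hdeg]
  refine eq_comm.mp (Polynomial.eq_of_monic_of_dvd_of_natDegree_le (minpoly.monic hint) hm ?_ (by rw [hd, h3]))
  apply minpoly.dvd
  simpa using hroot

/-- Let `a ≥ 3`, `ρ` the root of `x³ + (a−1)x² − ax − 1` lying in
`(1 + 1/(a+3), 1 + 1/(a+2))`, and `K = ℚ(ρ)` the corresponding Ennola cubic field.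
If `α` is indecomposable in `ℤ[ρ]` and `α` is not a unit of `ℤ[ρ]`, then the minimum of
`Tr_{K/ℚ}(αδ)` over all `δ ∈ ℤ[ρ]^{∨,+}` equals `2`. -/
theorem stmt_6 (a : ℤ) (ha : 3 ≤ a) (ρ : ℝ)
    (hroot : ρ ^ 3 + ((a : ℝ) - 1) * ρ ^ 2 - (a : ℝ) * ρ - 1 = 0)
    (hρ1 : 1 + 1 / ((a : ℝ) + 3) < ρ) (hρ2 : ρ < 1 + 1 / ((a : ℝ) + 2))
    (hdeg : Module.finrank ℚ ℚ⟮ρ⟯ = 3)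
    (α : ℚ⟮ρ⟯)
    (hind : IsIndecomposableIn (Algebra.adjoin ℤ {AdjoinSimple.gen ℚ ρ}) α)
    (hnotunit : ¬ ∃ β ∈ Algebra.adjoin ℤ {AdjoinSimple.gen ℚ ρ}, α * β = 1) :
    IsLeast {q : ℚ | ∃ δ ∈ CodifferentPlus (Algebra.adjoin ℤ {AdjoinSimple.gen ℚ ρ}),
      Algebra.trace ℚ ℚ⟮ρ⟯ (α * δ) = q} 2 := by
  have haR : (3 : ℝ) ≤ a := by exact_mod_cast ha
  have hx1 : 1 < ρ := lt_trans (by have : 0 < 1 / ((a : ℝ) + 3) := by positivity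
                                   linarith) hρ1
  have hx2 : ρ < 2 := by
    have : 1 / ((a : ℝ) + 2) ≤ 1 := by
      rw [div_le_one (by linarith)]; linarith
    linarith
  have hint : IsIntegral ℚ ρ := by
    have : FiniteDimensional ℚ ℚ⟮ρ⟯ := Module.finite_of_finrank_pos (by omega)
    exact IntermediateField.isIntegral_iff.mp
      (Algebra.IsIntegral.isIntegral (R := ℚ) (AdjoinSimple.gen ℚ ρ))
  have hmin := minpoly_eq a ρ hroot hint hdeg
  have : FiniteDimensional ℚ ℚ⟮ρ⟯ := Module.finite_of_finrank_pos (by omega)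
  -- the other roots
  set F : ℝ → ℝ := fun t => t ^ 3 + ((a : ℝ) - 1) * t ^ 2 - (a : ℝ) * t - 1 with hF
  have hFc : Continuous F := by fun_prop
  obtain ⟨y, ⟨hy1, hy2⟩, hy⟩ : (0 : ℝ) ∈ F '' Set.Ioo (-1) 0 := by
    refine intermediate_value_Ioo' (by norm_num) hFc.continuousOn ⟨?_, ?_⟩
    · simp [hF]
    · simp only [hF]; linarith
  obtain ⟨z, ⟨hz1, hz2⟩, hz⟩ : (0 : ℝ) ∈ F '' Set.Ioo (-(a : ℝ)) (-(a : ℝ) + 1) := by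
    refine intermediate_value_Ioo (by linarith) hFc.continuousOn ⟨?_, ?_⟩
    · simp only [hF]; ring_nf; norm_num
    · simp only [hF]; nlinarith
  simp only [hF] at hy hz
  have hxy : ρ - y ≠ 0 := by linarith
  have hxz : ρ - z ≠ 0 := by linarith
  have hyz : y - z ≠ 0 := by linarith
  have e1 : ρ ^ 2 + ρ * y + y ^ 2 + ((a : ℝ) - 1) * (ρ + y) - a = 0 := by
    apply mul_left_cancel₀ hxy; linear_combination hroot - hy
  have e2 : ρ ^ 2 + ρ * z + z ^ 2 + ((a : ℝ) - 1) * (ρ + z) - a = 0 := by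
    apply mul_left_cancel₀ hxz; linear_combination hroot - hz
  have hs1 : ρ + y + z = -((a : ℝ) - 1) := by
    apply mul_left_cancel₀ hyz; linear_combination e1 - e2
  have hs2 : ρ * y + y * z + ρ * z = -(a : ℝ) := by
    linear_combination (ρ + y) * hs1 - e1
  have hs3 : ρ * y * z = 1 := by
    linear_combination ρ * hs2 - ρ ^ 2 * hs1 + hroot
  -- embeddings
  set pb := IntermediateField.adjoin.powerBasis hint with hpb
  have hgen : pb.gen = AdjoinSimple.gen ℚ ρ := IntermediateField.adjoin.powerBasis_gen hint
  have hmg : minpoly ℚ pb.gen = minpoly ℚ ρ := by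
    rw [hgen]
    convert IntermediateField.minpoly_gen ℚ ρ
    · rfl
    · exact Subsingleton.elim _ _
  have emb : ∀ t : ℝ, t ^ 3 + ((a : ℝ) - 1) * t ^ 2 - (a : ℝ) * t - 1 = 0 →
      ∃ φ : ℚ⟮ρ⟯ →ₐ[ℚ] ℝ, φ (AdjoinSimple.gen ℚ ρ) = t := by
    intro t ht
    have : Polynomial.aeval t (minpoly ℚ pb.gen) = 0 := by
      rw [hmg, hmin]; simpa using ht
    exact ⟨pb.lift t this, by rw [← hgen]; exact pb.lift_gen t this⟩
  obtain ⟨φ₁, h1⟩ := emb ρ hroot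
  obtain ⟨φ₂, h2⟩ := emb y hy
  obtain ⟨φ₃, h3⟩ := emb z hz
  have hg0 : ∀ (ψ : ℚ⟮ρ⟯ →+* ℝ), (ψ (AdjoinSimple.gen ℚ ρ)) ^ 3 = 1 + a * ψ (AdjoinSimple.gen ℚ ρ)
      - (a - 1) * ψ (AdjoinSimple.gen ℚ ρ) ^ 2 → (AdjoinSimple.gen ℚ ρ) ^ 3 =
      1 + (a : ℚ⟮ρ⟯) * AdjoinSimple.gen ℚ ρ - (a - 1) * AdjoinSimple.gen ℚ ρ ^ 2 := by
    intro ψ h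
    apply ψ.injective
    simpa using h
  have hg := hg0 (φ₁ : ℚ⟮ρ⟯ →+* ℝ) (by
    have h1' : (φ₁ : ℚ⟮ρ⟯ →+* ℝ) (AdjoinSimple.gen ℚ ρ) = ρ := h1
    rw [h1']; linear_combination hroot)
  refine core_thm a ha (AdjoinSimple.gen ℚ ρ) hg φ₁ φ₂ φ₃ ρ y z h1 h2 h3 hx1 hx2 hy1 hy2 hz1 hz2
    hs1 hs2 hs3 ?_ ?_ α hind hnotunit
  · intro ψ
    have hψ : (ψ (AdjoinSimple.gen ℚ ρ)) ^ 3 = 1 + a * ψ (AdjoinSimple.gen ℚ ρ)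
        - (a - 1) * ψ (AdjoinSimple.gen ℚ ρ) ^ 2 := by
      have := congrArg ψ hg
      simpa using this
    have hext : ∀ χ : ℚ⟮ρ⟯ →ₐ[ℚ] ℝ, ψ (AdjoinSimple.gen ℚ ρ) = χ (AdjoinSimple.gen ℚ ρ) →
        ψ = (χ : ℚ⟮ρ⟯ →+* ℝ) := by
      intro χ h
      have : ψ.toRatAlgHom = χ := pb.algHom_ext (by rw [hgen]; exact h)
      rw [← this]; rfl
    set t := ψ (AdjoinSimple.gen ℚ ρ) with ht
    have : (t - ρ) * ((t - y) * (t - z)) = 0 := by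
      linear_combination hψ - t ^ 2 * hs1 + t * hs2 - hs3
    rcases mul_eq_zero.mp this with h | h
    · left; apply hext; rw [h1]; linarith
    rcases mul_eq_zero.mp h with h | h
    · right; left; apply hext; rw [h2]; linarith
    · right; right; apply hext; rw [h3]; linarith
  · intro u
    let c : ℝ →ₐ[ℚ] ℂ := Complex.ofRealAm.restrictScalars ℚ
    have hci : ∀ r : ℝ, c r = (r : ℂ) := fun r => rfl
    let Ψ : Fin 3 → (ℚ⟮ρ⟯ →ₐ[ℚ] ℂ) := ![c.comp φ₁, c.comp φ₂, c.comp φ₃]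
    have hval : ∀ i, Ψ i (AdjoinSimple.gen ℚ ρ) = ((![ρ, y, z] i : ℝ) : ℂ) := by
      intro i
      fin_cases i
      · simp [Ψ, hci, h1]
      · simp [Ψ, hci, h2]
      · simp [Ψ, hci, h3]
    have hinj : Function.Injective Ψ := by
      intro i j hij
      have h := (hval i).symm.trans ((congrArg (fun f => f (AdjoinSimple.gen ℚ ρ)) hij).trans (hval j))
      have h' := Complex.ofReal_injective h
      fin_cases i <;> fin_cases j <;> first | rfl | (exfalso; simp at h'; linarith)
    have hbij : Function.Bijective Ψ := by
      rw [Fintype.bijective_iff_injective_and_card]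
      refine ⟨hinj, ?_⟩
      rw [AlgHom.card, hdeg]; simp
    have htr := trace_eq_sum_embeddings (K := ℚ) (L := ℚ⟮ρ⟯) ℂ (x := u)
    rw [← (Equiv.ofBijective Ψ hbij).sum_comp, Fin.sum_univ_three] at htr
    apply Complex.ofReal_injective
    simpa [Ψ, hci] using htr
end
end

section
/- Let a ≥ 3 be a rational integer, ρ the root of x³ + (a−1)x² − ax − 1 lying in (1 + 1/(a+3), 1 + 1/(a+2)), and K = ℚ(ρ). Write a = 3A + a₀ with A a nonnegative integer and a₀ ∈ {0,1,2}. If α is indecomposable in ℤ[ρ], then N_{K/ℚ}(α) ≤ 3a² − 3a + 1 if a ≤ 4, and for a ≥ 5: N_{K/ℚ}(α) ≤ 4A³ + 18A² + 26A + 13 if a₀ = 2, N_{K/ℚ}(α) ≤ 4A³ + 14A² + 16A + 7 if a₀ = 1, and N_{K/ℚ}(α) ≤ 4A³ + 10A² + 8A + 3 if a₀ = 0. -/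
open IntermediateField

noncomputable section

/-- Positivity of the functional `x + z`. -/
lemma enn_pos1 (r1 r2 r3 x y z : ℝ) (h1 : 1 < r1) (h1' : r1 < 2)
    (h2 : -1/2 < r2) (h2' : r2 < 0) (h3' : r3 < -1)
    (p1 : 0 < x + y * r1 + z * r1 ^ 2) (p2 : 0 < x + y * r2 + z * r2 ^ 2)
    (p3 : 0 < x + y * r3 + z * r3 ^ 2) : 0 < x + z := by
  have c1 : 0 < (1 + r2 * r3) * (r2 - r3) := by
    apply mul_pos <;> nlinarith
  have c2 : 0 < (-(1 + r1 * r3)) * (r1 - r3) := by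
    apply mul_pos <;> nlinarith
  have c3 : 0 < (1 + r1 * r2) * (r1 - r2) := by
    apply mul_pos <;> nlinarith
  have hV : 0 < (r1 - r2) * (r1 - r3) * (r2 - r3) := by
    apply mul_pos (mul_pos _ _) <;> linarith
  have key : (x + z) * ((r1 - r2) * (r1 - r3) * (r2 - r3)) =
      (1 + r2 * r3) * (r2 - r3) * (x + y * r1 + z * r1 ^ 2)
      + (-(1 + r1 * r3)) * (r1 - r3) * (x + y * r2 + z * r2 ^ 2)
      + (1 + r1 * r2) * (r1 - r2) * (x + y * r3 + z * r3 ^ 2) := by ring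
  have := mul_pos c1 p1
  have := mul_pos c2 p2
  have := mul_pos c3 p3
  exact pos_of_mul_pos_left (by rw [key]; linarith) hV.le

/-- Positivity of the functional `a (x + z) - y`. -/
lemma enn_pos2 (a r1 r2 r3 x y z : ℝ) (ha : 3 ≤ a) (h1 : 1 < r1) (h1' : r1 < 2)
    (h2 : -1/2 < r2) (h2' : r2 < 0) (h3 : -a < r3) (h3' : r3 < -1)
    (p1 : 0 < x + y * r1 + z * r1 ^ 2) (p2 : 0 < x + y * r2 + z * r2 ^ 2)
    (p3 : 0 < x + y * r3 + z * r3 ^ 2) : 0 < a * (x + z) - y := by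
  have c1 : 0 < (a * (1 + r2 * r3) + r2 + r3) * (r2 - r3) := by
    apply mul_pos
    · have : 0 < (-r2) * (-(a * r3 + 1)) := by
        apply mul_pos <;> nlinarith
      nlinarith
    · linarith
  have c2 : 0 < (-(a * (1 + r1 * r3) + r1 + r3)) * (r1 - r3) := by
    apply mul_pos
    · have : 0 < (a * r1 + 1) * (-1 - r3) := by
        apply mul_pos <;> nlinarith
      nlinarith
    · linarith
  have c3 : 0 < (a * (1 + r1 * r2) + r1 + r2) * (r1 - r2) := by
    apply mul_pos
    · have : 0 < a * (1 + r1 * r2) := by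
        apply mul_pos <;> nlinarith
      linarith
    · linarith
  have hV : 0 < (r1 - r2) * (r1 - r3) * (r2 - r3) := by
    apply mul_pos (mul_pos _ _) <;> linarith
  have key : (a * (x + z) - y) * ((r1 - r2) * (r1 - r3) * (r2 - r3)) =
      (a * (1 + r2 * r3) + r2 + r3) * (r2 - r3) * (x + y * r1 + z * r1 ^ 2)
      + (-(a * (1 + r1 * r3) + r1 + r3)) * (r1 - r3) * (x + y * r2 + z * r2 ^ 2)
      + (a * (1 + r1 * r2) + r1 + r2) * (r1 - r2) * (x + y * r3 + z * r3 ^ 2) := by ring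
  have := mul_pos c1 p1
  have := mul_pos c2 p2
  have := mul_pos c3 p3
  exact pos_of_mul_pos_left (by rw [key]; linarith) hV.le

/-- The two other roots. -/
lemma enn_roots (a : ℝ) (ha : 3 ≤ a) : ∃ r2 r3 : ℝ, -1/2 < r2 ∧ r2 < 0 ∧ -a < r3 ∧ r3 < -1 ∧
    r2 ^ 3 + (a - 1) * r2 ^ 2 - a * r2 - 1 = 0 ∧ r3 ^ 3 + (a - 1) * r3 ^ 2 - a * r3 - 1 = 0 := by
  have hc : Continuous (fun t : ℝ => t ^ 3 + (a - 1) * t ^ 2 - a * t - 1) := by fun_prop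
  have e2 := intermediate_value_Ioo' (a := (-1/2 : ℝ)) (b := 0) (by norm_num) hc.continuousOn
  have e3 := intermediate_value_Ioo (a := (-a : ℝ)) (b := -1) (by linarith) hc.continuousOn
  obtain ⟨r2, hr2, h2⟩ := e2 (show (0 : ℝ) ∈ _ by constructor <;> norm_num <;> nlinarith)
  obtain ⟨r3, hr3, h3⟩ := e3 (show (0 : ℝ) ∈ _ by constructor <;> ring_nf <;> nlinarith)
  exact ⟨r2, r3, hr2.1, hr2.2, hr3.1, hr3.2, h2, h3⟩

/-- Signs at an arbitrary real root. -/
lemma enn_signs (a t : ℝ) (ha : 3 ≤ a) (ht : t ^ 3 + (a - 1) * t ^ 2 - a * t - 1 = 0) :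
    0 < t ^ 2 ∧ 0 < t + a ∧ 0 < t ^ 2 - t ∧ 0 < t ^ 2 + a * t + 1 ∧
      0 < (1 + a) - (a - 1) * t - t ^ 2 := by
  have h0 : t ≠ 0 := by rintro rfl; norm_num at ht
  have hk : (t ^ 2 - t) * (t + a) = 1 := by linarith
  have hs : 0 < t ^ 2 := by positivity
  have hta : 0 < t + a := by
    by_contra h
    push Not at h
    have : 0 < t ^ 2 - t := by nlinarith
    nlinarith
  have h3 : 0 < t ^ 2 - t := pos_of_mul_pos_left (by rw [hk]; norm_num) hta.le
  have h4 : 0 < t ^ 2 + a * t + 1 := by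
    have := mul_pos hs hta
    nlinarith
  refine ⟨hs, hta, h3, h4, ?_⟩
  have : ((1 + a) - (a - 1) * t - t ^ 2) * t ^ 2 = t ^ 2 - t := by
    linear_combination (-t) * ht
  exact pos_of_mul_pos_left (by rw [this]; exact h3) hs.le

/-- The combinatorial reduction: minimising the two functionals over the orbit. -/
lemma enn_reduce (a : ℤ) (ha : 3 ≤ a) (P : ℤ → ℤ → ℤ → Prop)
    (hpos1 : ∀ x y z, P x y z → 0 < x + z)
    (hpos2 : ∀ x y z, P x y z → 0 < a * (x + z) - y)
    (s1 : ∀ x y z, P x y z → P (a * x + z) (x + a * y + a * z) (y + z))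
    (s2 : ∀ x y z, P x y z →
      P (y - a * z) (-x + a * y + (1 - a ^ 2) * z) (x - a * y + a ^ 2 * z))
    (s3 : ∀ x y z, P x y z →
      P (x + y + z) (a * x + (a + 1) * y + (a + 1) * z) (x + y + 2 * z))
    (s4 : ∀ x y z, P x y z →
      P ((1 + a) * x - y) (y - (a - 1) * x - z) (z - x))
    (x y z : ℤ) (h : P x y z) : ∃ x y z, P x y z ∧
      ((0 ≤ x ∧ y ≤ 0 ∧ 0 ≤ y + z) ∨ (0 ≤ y ∧ y ≤ a * x ∧ y ≤ a * z)) := by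
  classical
  have hex : ∃ n : ℕ, ∃ x y z, P x y z ∧
      ((n : ℤ) = a * (x + z) ∨ (n : ℤ) = a * (x + z) - y) := by
    have h0 := hpos2 x y z h
    exact ⟨(a * (x + z) - y).toNat, x, y, z, h, Or.inr (by omega)⟩
  have hmin : ∀ x y z, P x y z → (Nat.find hex : ℤ) ≤ a * (x + z) ∧
      (Nat.find hex : ℤ) ≤ a * (x + z) - y := by
    intro x y z h
    have h0 := hpos2 x y z h
    have h1 : 0 < a * (x + z) := mul_pos (by omega) (hpos1 x y z h)
    have m1 := Nat.find_min' hex (m := (a * (x + z)).toNat) ⟨x, y, z, h, Or.inl (by omega)⟩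
    have m2 := Nat.find_min' hex (m := (a * (x + z) - y).toNat) ⟨x, y, z, h, Or.inr (by omega)⟩
    omega
  obtain ⟨x, y, z, hP, hn⟩ := Nat.find_spec hex
  have q0 := hmin _ _ _ hP
  have q1 := (hmin _ _ _ (s1 _ _ _ hP)).2
  have q2 := (hmin _ _ _ (s2 _ _ _ hP)).1
  have q3 := (hmin _ _ _ (s3 _ _ _ hP)).2
  have q4 := (hmin _ _ _ (s4 _ _ _ hP)).1
  have hc : 0 < a ^ 2 - a - 1 := by nlinarith
  have hd : 0 < a - 1 := by omega
  refine ⟨x, y, z, hP, ?_⟩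
  rcases hn with hn | hn <;> rw [hn] at q0 q1 q2 q3 q4
  · left
    refine ⟨?_, by omega, ?_⟩
    · apply nonneg_of_mul_nonneg_right _ hc
      linarith
    · apply nonneg_of_mul_nonneg_right _ hd
      linarith
  · right
    refine ⟨by omega, ?_, ?_⟩
    · have : 0 ≤ a * x - y := by
        apply nonneg_of_mul_nonneg_right _ hd
        linarith
      linarith
    · have : 0 ≤ a * z - y := by
        apply nonneg_of_mul_nonneg_right _ hc
        linarith
      linarith

/-- The final numerical bounds. -/
lemma enn_bounds (a A a₀ k : ℤ) (hA : 0 ≤ A) (haA : a = 3 * A + a₀) (hk : 1 ≤ k) (hka : k < a) :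
    (a ≤ 4 → 1 + (k + 2) * (a - k) * (a - k + 1) ≤ 3 * a ^ 2 - 3 * a + 1) ∧
    (5 ≤ a → a₀ = 2 →
      1 + (k + 2) * (a - k) * (a - k + 1) ≤ 4 * A ^ 3 + 18 * A ^ 2 + 26 * A + 13) ∧
    (5 ≤ a → a₀ = 1 →
      1 + (k + 2) * (a - k) * (a - k + 1) ≤ 4 * A ^ 3 + 14 * A ^ 2 + 16 * A + 7) ∧
    (5 ≤ a → a₀ = 0 →
      1 + (k + 2) * (a - k) * (a - k + 1) ≤ 4 * A ^ 3 + 10 * A ^ 2 + 8 * A + 3) := by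
  refine ⟨?_, ?_, ?_, ?_⟩
  · intro h
    have h1 : k ≤ 3 := by omega
    interval_cases k
    · nlinarith
    · have : a = 3 ∨ a = 4 := by omega
      rcases this with rfl | rfl <;> norm_num
    · have : a = 4 := by omega
      subst this; norm_num
  · rintro - rfl
    obtain ⟨m, rfl⟩ : ∃ m, k = A + m := ⟨k - A, by ring⟩
    subst haA
    have : 0 ≤ m * (3 * A + 4 + m * (3 * A + 3 - m)) := by
      rcases le_or_gt 0 m with hm | hm
      · have : 0 ≤ 3 * A + 3 - m := by omega
        positivity
      · nlinarith [mul_nonneg (show 0 ≤ -m by omega) (show 0 ≤ -m - 1 by omega),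
          mul_nonneg (mul_nonneg (show 0 ≤ -m by omega) (show 0 ≤ -m - 1 by omega)) hA,
          mul_nonneg (mul_nonneg (show 0 ≤ -m by omega) (show 0 ≤ -m - 1 by omega))
            (show 0 ≤ -m by omega)]
    linarith
  · rintro - rfl
    obtain ⟨m, rfl⟩ : ∃ m, k = A - 1 + m := ⟨k - (A - 1), by ring⟩
    subst haA
    have : 0 ≤ m * (m * (3 * A + 4 - m) - (A + 1)) := by
      rcases lt_trichotomy 0 m with hm | hm | hm
      · apply mul_nonneg hm.le
        have h1 : A + 1 ≤ 3 * A + 4 - m := by omega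
        nlinarith
      · subst hm; simp
      · apply mul_nonneg_of_nonpos_of_nonpos hm.le
        have h1 : 0 ≤ 3 * A + 4 - m := by omega
        nlinarith
    linarith
  · rintro - rfl
    obtain ⟨m, rfl⟩ : ∃ m, k = A - 1 + m := ⟨k - (A - 1), by ring⟩
    subst haA
    have : 0 ≤ m * (A + 1 + m * (3 * A + 2 - m)) := by
      rcases lt_trichotomy 0 m with hm | hm | hm
      · apply mul_nonneg hm.le
        have h1 : 0 ≤ 3 * A + 2 - m := by omega
        nlinarith
      · subst hm; simp
      · apply mul_nonneg_of_nonpos_of_nonpos hm.le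
        have h1 : A + 1 ≤ 3 * A + 2 - m := by omega
        nlinarith
    linarith

/-- Norm `1` is below all bounds. -/
lemma enn_bounds_one (a A a₀ : ℤ) (ha : 3 ≤ a) (hA : 0 ≤ A) :
    (a ≤ 4 → 1 ≤ 3 * a ^ 2 - 3 * a + 1) ∧
    (5 ≤ a → a₀ = 2 → 1 ≤ 4 * A ^ 3 + 18 * A ^ 2 + 26 * A + 13) ∧
    (5 ≤ a → a₀ = 1 → 1 ≤ 4 * A ^ 3 + 14 * A ^ 2 + 16 * A + 7) ∧
    (5 ≤ a → a₀ = 0 → 1 ≤ 4 * A ^ 3 + 10 * A ^ 2 + 8 * A + 3) := by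
  have := pow_nonneg hA 3
  have := pow_nonneg hA 2
  refine ⟨fun _ => by nlinarith, fun _ _ => by linarith, fun _ _ => by linarith,
    fun _ _ => by linarith⟩

lemma TotallyPositive.mul' {K : Type*} [Field K] {x y : K} (hx : TotallyPositive x)
    (hy : TotallyPositive y) : TotallyPositive (x * y) := fun φ => by
  rw [map_mul]; exact mul_pos (hx φ) (hy φ)

lemma TotallyPositive.add' {K : Type*} [Field K] {x y : K} (hx : TotallyPositive x)
    (hy : TotallyPositive y) : TotallyPositive (x + y) := fun φ => by
  rw [map_add]; exact add_pos (hx φ) (hy φ)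

/-- Multiplying by a totally positive unit preserves indecomposability. -/
lemma IsIndecomposableIn.mul_unit {K : Type*} [Field K] {O : Subalgebra ℤ K} {α e e' : K}
    (h : IsIndecomposableIn O α) (he : e ∈ O) (he' : e' ∈ O) (hp : TotallyPositive e)
    (hp' : TotallyPositive e') (hee : e * e' = 1) : IsIndecomposableIn O (e * α) := by
  refine ⟨O.mul_mem he h.1, hp.mul' h.2.1, ?_⟩
  rintro ⟨β, γ, hβ, hγ, tβ, tγ, heq⟩
  exact h.2.2 ⟨e' * β, e' * γ, O.mul_mem he' hβ, O.mul_mem he' hγ, hp'.mul' tβ, hp'.mul' tγ, by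
    linear_combination e' * heq - α * hee⟩

/-- An indecomposable that is a sum with nonnegative integer coefficients of totally positive
elements `u, v, w` and possibly one more is one of them. -/
lemma IsIndecomposableIn.not_add {K : Type*} [Field K] {O : Subalgebra ℤ K} {α β γ : K}
    (h : IsIndecomposableIn O α) (hβ : β ∈ O) (hγ : γ ∈ O) (tβ : TotallyPositive β)
    (tγ : γ = 0 ∨ TotallyPositive γ) (he : α = β + γ) : α = β := by
  rcases tγ with rfl | tγ
  · simpa using he
  · exact absurd ⟨β, γ, hβ, hγ, tβ, tγ, he⟩ h.2.2

lemma enn_smul {K : Type*} [Field K] {u : K} (hu : TotallyPositive u) (n : ℤ) (hn : 0 ≤ n) :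
    (n : K) * u = 0 ∨ TotallyPositive ((n : K) * u) := by
  rcases hn.eq_or_lt with rfl | hn
  · left; simp
  · right
    intro φ
    rw [map_mul, map_intCast]
    exact mul_pos (by exact_mod_cast hn) (hu φ)

lemma enn_add {K : Type*} [Field K] {u v : K} (hu : u = 0 ∨ TotallyPositive u)
    (hv : v = 0 ∨ TotallyPositive v) : u + v = 0 ∨ TotallyPositive (u + v) := by
  rcases hu with rfl | hu
  · simpa using hv
  · rcases hv with rfl | hv
    · right; simpa using hu
    · exact Or.inr (hu.add' hv)

lemma enn_comb {K : Type*} [Field K] (φ : K →+* ℝ) {O : Subalgebra ℤ K} {α u v w : K}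
    (h : IsIndecomposableIn O α) (hu : u ∈ O) (hv : v ∈ O) (hw : w ∈ O)
    (tu : TotallyPositive u) (tv : TotallyPositive v) (tw : TotallyPositive w)
    (p q r : ℤ) (hp : 0 ≤ p) (hq : 0 ≤ q) (hr : 0 ≤ r) (he : α = p * u + q * v + r * w) :
    α = u ∨ α = v ∨ α = w := by
  have mem : ∀ (n : ℤ) (x : K), x ∈ O → (n : K) * x ∈ O := fun n x hx =>
    O.mul_mem (intCast_mem O n) hx
  rcases hp.eq_or_lt with rfl | hp
  · rcases hq.eq_or_lt with rfl | hq
    · rcases hr.eq_or_lt with rfl | hr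
      · exfalso
        have h0 := h.2.1 φ
        rw [he] at h0
        simp at h0
      · right; right
        refine h.not_add hw (mem (r - 1) w hw) tw (enn_smul tw _ (by omega)) ?_
        rw [he]; push_cast; ring
    · right; left
      refine h.not_add hv (O.add_mem (mem (q - 1) v hv) (mem r w hw)) tv
        (enn_add (enn_smul tv _ (by omega)) (enn_smul tw _ hr)) ?_
      rw [he]; push_cast; ring
  · left
    refine h.not_add hu (O.add_mem (O.add_mem (mem (p - 1) u hu) (mem q v hv)) (mem r w hw)) tu
      (enn_add (enn_add (enn_smul tu _ (by omega)) (enn_smul tv _ hq)) (enn_smul tw _ hr)) ?_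
    rw [he]; push_cast; ring

/-- Norm form in the basis `1, g, g²`. -/
lemma enn_norm {K : Type*} [Field K] [Algebra ℚ K] (a : ℤ) (g : K)
    (hg : g ^ 3 + ((a : K) - 1) * g ^ 2 - (a : K) * g - 1 = 0)
    (b : Module.Basis (Fin 3) ℚ K) (hb : ∀ i, b i = g ^ (i : ℕ)) (x y z : ℤ) :
    Algebra.norm ℚ ((x : K) + y * g + z * g ^ 2) =
      (Matrix.det !![(x : ℚ), z, y - (a - 1) * z; y, x + a * z, z + a * (y - (a - 1) * z);
        z, y - (a - 1) * z, x + a * z - (a - 1) * (y - (a - 1) * z)]) := by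
  have : CharZero K := algebraRat.charZero K
  rw [Algebra.norm_apply, ← LinearMap.det_toLin b]
  congr 1
  apply b.ext
  intro i
  rw [Matrix.toLin_self]
  simp only [Fin.sum_univ_three, hb, Algebra.smul_def]
  fin_cases i
  · simp
  · simp
    linear_combination z * hg
  · simp
    linear_combination (y + z * g - (a - 1) * z) * hg

/-- Elements of `ℤ[g]` have integer coordinates. -/
lemma enn_coords {K : Type*} [Field K] (a : ℤ) (g : K)
    (hg : g ^ 3 + ((a : K) - 1) * g ^ 2 - (a : K) * g - 1 = 0) (α : K)
    (hα : α ∈ Algebra.adjoin ℤ {g}) : ∃ x y z : ℤ, α = (x : K) + y * g + z * g ^ 2 := by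
  induction hα using Algebra.adjoin_induction with
  | mem w hw => exact ⟨0, 1, 0, by rw [Set.mem_singleton_iff.1 hw]; simp⟩
  | algebraMap r => exact ⟨r, 0, 0, by simp⟩
  | add u v _ _ hu hv =>
    obtain ⟨x, y, z, rfl⟩ := hu
    obtain ⟨x', y', z', rfl⟩ := hv
    exact ⟨x + x', y + y', z + z', by push_cast; ring⟩
  | mul u v _ _ hu hv =>
    obtain ⟨x, y, z, rfl⟩ := hu
    obtain ⟨p, q, r, rfl⟩ := hv
    refine ⟨x * p + y * r + z * (q - (a - 1) * r),
      x * q + y * (p + a * r) + z * (r + a * (q - (a - 1) * r)),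
      x * r + y * (q - (a - 1) * r) + z * (p + a * r - (a - 1) * (q - (a - 1) * r)), ?_⟩
    push_cast
    linear_combination (y * r + z * (q + r * g - (a - 1) * r)) * hg

/-- The main argument, in an abstract field. -/
lemma enn_main {K : Type*} [Field K] [Algebra ℚ K] (a : ℤ) (ha : 3 ≤ a) (g : K)
    (hg : g ^ 3 + ((a : K) - 1) * g ^ 2 - (a : K) * g - 1 = 0)
    (b : Module.Basis (Fin 3) ℚ K) (hb : ∀ i, b i = g ^ (i : ℕ))
    (hemb : ∀ t : ℝ, t ^ 3 + ((a : ℝ) - 1) * t ^ 2 - (a : ℝ) * t - 1 = 0 →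
      ∃ φ : K →+* ℝ, φ g = t)
    (ρ : ℝ) (hρ : ρ ^ 3 + ((a : ℝ) - 1) * ρ ^ 2 - (a : ℝ) * ρ - 1 = 0) (hρ1 : 1 < ρ)
    (hρ2 : ρ < 2) (α : K) (hind : IsIndecomposableIn (Algebra.adjoin ℤ {g}) α) :
    Algebra.norm ℚ α = 1 ∨ ∃ k : ℤ, 1 ≤ k ∧ k < a ∧
      Algebra.norm ℚ α = ((1 + (k + 2) * (a - k) * (a - k + 1) : ℤ) : ℚ) := by
  have haR : (3 : ℝ) ≤ a := by exact_mod_cast ha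
  obtain ⟨r2, r3, h2, h2', h3, h3', f2, f3⟩ := enn_roots a haR
  obtain ⟨φ1, e1⟩ := hemb ρ hρ
  obtain ⟨φ2, e2⟩ := hemb r2 f2
  obtain ⟨φ3, e3⟩ := hemb r3 f3
  set O := Algebra.adjoin ℤ {g} with hO
  have gO : g ∈ O := Algebra.subset_adjoin rfl
  have cO : ∀ n : ℤ, (n : K) ∈ O := fun n => intCast_mem O n
  have elO : ∀ x y z : ℤ, (x : K) + y * g + z * g ^ 2 ∈ O := fun x y z =>
    O.add_mem (O.add_mem (cO _) (O.mul_mem (cO _) gO)) (O.mul_mem (cO _) (O.pow_mem gO 2))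
  have hsig : ∀ φ : K →+* ℝ, 0 < φ g ^ 2 ∧ 0 < φ g + a ∧ 0 < φ g ^ 2 - φ g ∧
      0 < φ g ^ 2 + a * φ g + 1 ∧ 0 < (1 + a) - (a - 1) * φ g - φ g ^ 2 := by
    intro φ
    apply enn_signs a (φ g) haR
    have := congrArg φ hg
    simpa using this
  have hφ : ∀ (φ : K →+* ℝ) (x y z : ℤ), φ ((x : K) + y * g + z * g ^ 2) =
      x + y * φ g + z * φ g ^ 2 := by
    intro φ x y z; simp
  -- the units
  have t1 : TotallyPositive (((1 : ℤ) : K) + (0 : ℤ) * g + (0 : ℤ) * g ^ 2) := fun φ => by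
    rw [hφ]; norm_num
  have t2 : TotallyPositive (((0 : ℤ) : K) + (0 : ℤ) * g + (1 : ℤ) * g ^ 2) := fun φ => by
    rw [hφ]; push_cast; linarith [(hsig φ).1]
  have t3 : TotallyPositive (((a : ℤ) : K) + (1 : ℤ) * g + (0 : ℤ) * g ^ 2) := fun φ => by
    rw [hφ]; push_cast; linarith [(hsig φ).2.1]
  have t4 : TotallyPositive (((0 : ℤ) : K) + (-1 : ℤ) * g + (1 : ℤ) * g ^ 2) := fun φ => by
    rw [hφ]; push_cast; linarith [(hsig φ).2.2.1]
  have t5 : TotallyPositive (((1 : ℤ) : K) + (a : ℤ) * g + (1 : ℤ) * g ^ 2) := fun φ => by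
    rw [hφ]; push_cast; linarith [(hsig φ).2.2.2.1]
  have t6 : TotallyPositive (((1 + a : ℤ) : K) + (1 - a : ℤ) * g + (-1 : ℤ) * g ^ 2) :=
    fun φ => by
      rw [hφ]; push_cast; linarith [(hsig φ).2.2.2.2]
  have tk : ∀ k : ℤ, 1 ≤ k → k < a →
      TotallyPositive (((1 : ℤ) : K) + (k : ℤ) * g + (1 : ℤ) * g ^ 2) := fun k hk hka φ => by
    rw [hφ]; push_cast
    have hkR : (1 : ℝ) ≤ k := by exact_mod_cast hk
    have hkaR : (k : ℝ) < a := by exact_mod_cast hka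
    have A1 := mul_pos (by linarith : (0 : ℝ) < k) (hsig φ).2.2.2.1
    have A2 := mul_pos (by linarith : (0 : ℝ) < a - k) (by nlinarith [(hsig φ).1] :
      0 < 1 + φ g ^ 2)
    refine pos_of_mul_pos_right (a := (a : ℝ)) ?_ (by linarith)
    linarith
  have u34 : (((a : ℤ) : K) + (1 : ℤ) * g + (0 : ℤ) * g ^ 2) *
      (((0 : ℤ) : K) + (-1 : ℤ) * g + (1 : ℤ) * g ^ 2) = 1 := by
    push_cast; linear_combination hg
  have u56 : (((1 : ℤ) : K) + (a : ℤ) * g + (1 : ℤ) * g ^ 2) *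
      (((1 + a : ℤ) : K) + (1 - a : ℤ) * g + (-1 : ℤ) * g ^ 2) = 1 := by
    push_cast; linear_combination (-g - a) * hg
  have nrm := enn_norm a g hg b hb
  have n1 : Algebra.norm ℚ (((1 : ℤ) : K) + (0 : ℤ) * g + (0 : ℤ) * g ^ 2) = 1 := by
    rw [nrm, Matrix.det_fin_three]; simp
  have n2 : Algebra.norm ℚ (((0 : ℤ) : K) + (0 : ℤ) * g + (1 : ℤ) * g ^ 2) = 1 := by
    rw [nrm, Matrix.det_fin_three]; simp; ring
  have n3 : Algebra.norm ℚ (((a : ℤ) : K) + (1 : ℤ) * g + (0 : ℤ) * g ^ 2) = 1 := by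
    rw [nrm, Matrix.det_fin_three]; simp
  have n4 : Algebra.norm ℚ (((0 : ℤ) : K) + (-1 : ℤ) * g + (1 : ℤ) * g ^ 2) = 1 := by
    rw [nrm, Matrix.det_fin_three]; simp; ring
  have n5 : Algebra.norm ℚ (((1 : ℤ) : K) + (a : ℤ) * g + (1 : ℤ) * g ^ 2) = 1 := by
    rw [nrm, Matrix.det_fin_three]; simp; ring
  have n6 : Algebra.norm ℚ (((1 + a : ℤ) : K) + (1 - a : ℤ) * g + (-1 : ℤ) * g ^ 2) = 1 := by
    rw [nrm, Matrix.det_fin_three]; simp; ring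
  have nk : ∀ k : ℤ, Algebra.norm ℚ (((1 : ℤ) : K) + (k : ℤ) * g + (1 : ℤ) * g ^ 2) =
      ((1 + (k + 2) * (a - k) * (a - k + 1) : ℤ) : ℚ) := fun k => by
    rw [nrm, Matrix.det_fin_three]; simp; ring
  obtain ⟨x0, y0, z0, hα⟩ := enn_coords a g hg α hind.1
  let P : ℤ → ℤ → ℤ → Prop := fun x y z =>
    IsIndecomposableIn O ((x : K) + y * g + z * g ^ 2) ∧
      Algebra.norm ℚ ((x : K) + y * g + z * g ^ 2) = Algebra.norm ℚ α
  have step : ∀ e e' : K, e ∈ O → e' ∈ O → TotallyPositive e → TotallyPositive e' → e * e' = 1 →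
      Algebra.norm ℚ e = 1 → ∀ x y z x' y' z' : ℤ, P x y z →
      e * ((x : K) + y * g + z * g ^ 2) = (x' : K) + y' * g + z' * g ^ 2 → P x' y' z' := by
    intro e e' he he' te te' hee hn x y z x' y' z' hP heq
    refine ⟨?_, ?_⟩
    · rw [← heq]; exact hP.1.mul_unit he he' te te' hee
    · rw [← heq, map_mul, hn, one_mul]; exact hP.2
  obtain ⟨x, y, z, hP, hcase⟩ := enn_reduce a ha P
    (by
      intro x y z hP
      have p1 := hP.1.2.1 φ1
      have p2 := hP.1.2.1 φ2
      have p3 := hP.1.2.1 φ3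
      rw [hφ, e1] at p1
      rw [hφ, e2] at p2
      rw [hφ, e3] at p3
      exact_mod_cast enn_pos1 ρ r2 r3 x y z hρ1 hρ2 h2 h2' h3' p1 p2 p3)
    (by
      intro x y z hP
      have p1 := hP.1.2.1 φ1
      have p2 := hP.1.2.1 φ2
      have p3 := hP.1.2.1 φ3
      rw [hφ, e1] at p1
      rw [hφ, e2] at p2
      rw [hφ, e3] at p3
      exact_mod_cast enn_pos2 a ρ r2 r3 x y z haR hρ1 hρ2 h2 h2' h3 h3' p1 p2 p3)
    (by
      intro x y z hP
      refine step _ _ (elO _ _ _) (elO _ _ _) t3 t4 u34 n3 x y z _ _ _ hP ?_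
      push_cast
      linear_combination z * hg)
    (by
      intro x y z hP
      refine step _ _ (elO _ _ _) (elO _ _ _) t4 t3 (by rw [mul_comm]; exact u34) n4
        x y z _ _ _ hP ?_
      push_cast
      linear_combination (y - a * z + z * g) * hg)
    (by
      intro x y z hP
      refine step _ _ (elO _ _ _) (elO _ _ _) t5 t6 u56 n5 x y z _ _ _ hP ?_
      push_cast
      linear_combination (y + z + z * g) * hg)
    (by
      intro x y z hP
      refine step _ _ (elO _ _ _) (elO _ _ _) t6 t5 (by rw [mul_comm]; exact u56) n6
        x y z _ _ _ hP ?_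
      push_cast
      linear_combination (-y - z * g) * hg)
    x0 y0 z0 ⟨by rw [← hα]; exact hind, by rw [← hα]⟩
  obtain ⟨hI, hN⟩ := hP
  rw [← hN]
  rcases hcase with ⟨hx, hy, hyz⟩ | ⟨hy, hx, hz⟩
  · left
    rcases enn_comb φ1 hI (elO _ _ _) (elO _ _ _) (elO _ _ _) t1 t4 t2 x (-y) (y + z) hx
      (by omega) hyz (by push_cast; ring) with h | h | h
    · rw [h, n1]
    · rw [h, n4]
    · rw [h, n2]
  · obtain ⟨q, k, hk, hka, rfl⟩ : ∃ q k : ℤ, 0 ≤ k ∧ k < a ∧ y = a * q + k :=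
      ⟨y / a, y % a, Int.emod_nonneg _ (by omega), Int.emod_lt_of_pos _ (by omega),
        (Int.mul_ediv_add_emod y a).symm⟩
    have hq : 0 ≤ q := by
      by_contra h
      have : q ≤ -1 := by omega
      nlinarith
    rcases hk.eq_or_lt with rfl | hk
    · left
      have hx' : q ≤ x := by
        apply le_of_mul_le_mul_left (a := a) _ (by omega)
        linarith
      have hz' : q ≤ z := by
        apply le_of_mul_le_mul_left (a := a) _ (by omega)
        linarith
      rcases enn_comb φ1 hI (elO _ _ _) (elO _ _ _) (elO _ _ _) t1 t5 t2 (x - q) q (z - q)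
        (by omega) hq (by omega) (by push_cast; ring) with h | h | h
      · rw [h, n1]
      · rw [h, n5]
      · rw [h, n2]
    · right
      have hx' : q < x := by
        apply lt_of_mul_lt_mul_left (a := a) _ (by omega)
        linarith
      have hz' : q < z := by
        apply lt_of_mul_lt_mul_left (a := a) _ (by omega)
        linarith
      refine ⟨k, hk, hka, ?_⟩
      rw [← nk k]
      congr 1
      refine hI.not_add (elO _ _ _) (γ := ((x - q - 1 : ℤ) : K) *
          (((1 : ℤ) : K) + (0 : ℤ) * g + (0 : ℤ) * g ^ 2) +
        ((q : ℤ) : K) * (((1 : ℤ) : K) + (a : ℤ) * g + (1 : ℤ) * g ^ 2) +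
        ((z - q - 1 : ℤ) : K) * (((0 : ℤ) : K) + (0 : ℤ) * g + (1 : ℤ) * g ^ 2))
        (O.add_mem (O.add_mem (O.mul_mem (cO _) (elO _ _ _)) (O.mul_mem (cO _) (elO _ _ _)))
          (O.mul_mem (cO _) (elO _ _ _))) (tk k hk hka)
        (enn_add (enn_add (enn_smul t1 _ (by omega)) (enn_smul t5 _ hq))
          (enn_smul t2 _ (by omega))) ?_
      push_cast
      ring

/-- Let `a ≥ 3`, `ρ` the root of `x³ + (a−1)x² − ax − 1` lying in
`(1 + 1/(a+3), 1 + 1/(a+2))`, and `K = ℚ(ρ)`. Write `a = 3A + a₀` with `A ≥ 0` and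
`a₀ ∈ {0,1,2}`. If `α` is indecomposable in `ℤ[ρ]`, then `N(α) ≤ 3a² − 3a + 1` if `a ≤ 4`,
and for `a ≥ 5`: `N(α) ≤ 4A³ + 18A² + 26A + 13` if `a₀ = 2`,
`N(α) ≤ 4A³ + 14A² + 16A + 7` if `a₀ = 1`, and `N(α) ≤ 4A³ + 10A² + 8A + 3` if `a₀ = 0`. -/
theorem stmt_7 (a A a₀ : ℤ) (ha : 3 ≤ a) (hA : 0 ≤ A)
    (ha₀ : a₀ = 0 ∨ a₀ = 1 ∨ a₀ = 2) (haA : a = 3 * A + a₀)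
    (ρ : ℝ)
    (hroot : ρ ^ 3 + ((a : ℝ) - 1) * ρ ^ 2 - (a : ℝ) * ρ - 1 = 0)
    (hρ1 : 1 + 1 / ((a : ℝ) + 3) < ρ) (hρ2 : ρ < 1 + 1 / ((a : ℝ) + 2))
    (hdeg : Module.finrank ℚ ℚ⟮ρ⟯ = 3)
    (α : ℚ⟮ρ⟯)
    (hind : IsIndecomposableIn (Algebra.adjoin ℤ {AdjoinSimple.gen ℚ ρ}) α) :
    (a ≤ 4 → Algebra.norm ℚ α ≤ ((3 * a ^ 2 - 3 * a + 1 : ℤ) : ℚ)) ∧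
    (5 ≤ a → a₀ = 2 →
      Algebra.norm ℚ α ≤ ((4 * A ^ 3 + 18 * A ^ 2 + 26 * A + 13 : ℤ) : ℚ)) ∧
    (5 ≤ a → a₀ = 1 →
      Algebra.norm ℚ α ≤ ((4 * A ^ 3 + 14 * A ^ 2 + 16 * A + 7 : ℤ) : ℚ)) ∧
    (5 ≤ a → a₀ = 0 →
      Algebra.norm ℚ α ≤ ((4 * A ^ 3 + 10 * A ^ 2 + 8 * A + 3 : ℤ) : ℚ)) := by
  have haR : (3 : ℝ) ≤ a := by exact_mod_cast ha
  have h1 : 1 < ρ := by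
    have : 0 < 1 / ((a : ℝ) + 3) := by positivity
    linarith
  have h2 : ρ < 2 := by
    have : 1 / ((a : ℝ) + 2) ≤ 1 := by
      rw [div_le_one (by linarith)]; linarith
    linarith
  let f : Polynomial ℚ := Polynomial.X ^ 3 + (Polynomial.C ((a : ℚ) - 1) * Polynomial.X ^ 2 +
    Polynomial.C (-(a : ℚ)) * Polynomial.X + Polynomial.C (-1))
  have hfd : (Polynomial.C ((a : ℚ) - 1) * Polynomial.X ^ 2 +
    Polynomial.C (-(a : ℚ)) * Polynomial.X + Polynomial.C (-1)).degree < ((3 : ℕ) : WithBot ℕ) :=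
    lt_of_le_of_lt Polynomial.degree_quadratic_le (by norm_num)
  have hfm : f.Monic := Polynomial.monic_X_pow_add hfd
  have hfn : f.natDegree = 3 := by
    apply Polynomial.natDegree_eq_of_degree_eq_some
    rw [Polynomial.degree_add_eq_left_of_degree_lt] <;> rw [Polynomial.degree_X_pow]
    exact hfd
  have hfe : ∀ t : ℝ, Polynomial.aeval t f =
      t ^ 3 + ((a : ℝ) - 1) * t ^ 2 - (a : ℝ) * t - 1 := by
    intro t
    simp [f]
    ring
  have hint : IsIntegral ℚ ρ := ⟨f, hfm, by
    have := hfe ρ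
    rw [hroot] at this
    exact this⟩
  have hmin : minpoly ℚ ρ = f := by
    symm
    apply Polynomial.eq_of_monic_of_dvd_of_natDegree_le (minpoly.monic hint) hfm
      (minpoly.dvd ℚ ρ (by rw [hfe, hroot]))
    rw [hfn, ← IntermediateField.adjoin.finrank hint, hdeg]
  let pb := IntermediateField.adjoin.powerBasis hint
  have hdim : pb.dim = 3 := by rw [← pb.finrank, hdeg]
  have hgen : pb.gen = AdjoinSimple.gen ℚ ρ := IntermediateField.adjoin.powerBasis_gen hint
  let b : Module.Basis (Fin 3) ℚ ℚ⟮ρ⟯ := pb.basis.reindex (finCongr hdim)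
  have hb : ∀ i, b i = (AdjoinSimple.gen ℚ ρ) ^ (i : ℕ) := by
    intro i
    simp [b, hgen]
  have hg : (AdjoinSimple.gen ℚ ρ) ^ 3 + ((a : ℚ⟮ρ⟯) - 1) * (AdjoinSimple.gen ℚ ρ) ^ 2
      - (a : ℚ⟮ρ⟯) * (AdjoinSimple.gen ℚ ρ) - 1 = 0 := by
    apply Subtype.ext
    simpa using hroot
  have hemb : ∀ t : ℝ, t ^ 3 + ((a : ℝ) - 1) * t ^ 2 - (a : ℝ) * t - 1 = 0 →
      ∃ φ : ℚ⟮ρ⟯ →+* ℝ, φ (AdjoinSimple.gen ℚ ρ) = t := by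
    intro t ht
    have hm := IntermediateField.minpoly_gen ℚ ρ
    rw [hmin, ← hgen] at hm
    refine ⟨(pb.lift t (by rw [hm, hfe, ht])).toRingHom, ?_⟩
    have := pb.lift_gen t (by rw [hm, hfe, ht])
    exact (congrArg _ hgen.symm).trans this
  rcases enn_main a ha _ hg b hb hemb ρ hroot h1 h2 α hind with h | ⟨k, hk, hka, h⟩
  · rw [h]
    have := enn_bounds_one a A a₀ ha hA
    exact_mod_cast this
  · rw [h]
    have := enn_bounds a A a₀ k hA haA hk hka
    simpa only [Int.cast_le] using this
end
end
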